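/- arXiv:2410.10064 — 2 statements merged into one kernel-verified Lean document; each statement's English description precedes it below -/
import Mathlib

section
/- Let H be a finite-dimensional Hopf algebra over a field k and let A be a right coideal subalgebra of H. Then dim_k(A) · dim_k(H/A⁺H) = dim_k(H), where A⁺ = A ∩ ker(ε) and A⁺H denotes the k-linear span of the products ah with a ∈ A⁺ and h ∈ H. -/
open scoped TensorProduct

noncomputable section

/-- A subalgebra `A` of a Hopf algebra (or bialgebra) `H` is a *right coideal subalgebra*
if `Δ(A) ⊆ A ⊗ H`. -/
def IsRightCoidealSubalgebra (k : Type*) {H : Type*} [CommSemiring k] [Semiring H]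
    [Algebra k H] [CoalgebraStruct k H] (A : Subalgebra k H) : Prop :=
  ∀ a ∈ A, Coalgebra.comul (R := k) a ∈
    LinearMap.range (TensorProduct.map (Subalgebra.toSubmodule A).subtype
      (LinearMap.id (R := k) (M := H)))

namespace CoidealFree

set_option linter.unusedSectionVars false

section Antipode

variable {k : Type*} [Field k] {H : Type*} [Ring H] [HopfAlgebra k H]

open WithConv in
theorem antipode_surjective [FiniteDimensional k H] :
    Function.Surjective (HopfAlgebra.antipode k (A := H)) := by
  set S := HopfAlgebra.antipode k (A := H) with hS
  -- maps into the range of `S`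
  have hmul : ∀ f g : WithConv (H →ₗ[k] H), (∀ x, f x ∈ LinearMap.range S) →
      (∀ x, g x ∈ LinearMap.range S) → ∀ x, (f * g) x ∈ LinearMap.range S := by
    intro f g hf hg x
    rw [LinearMap.convMul_apply]
    induction Coalgebra.comul (R := k) x using TensorProduct.induction_on with
    | zero => simp
    | add a b ha hb => rw [map_add, map_add]; exact add_mem ha hb
    | tmul a b =>
      obtain ⟨a', ha'⟩ := hf a
      obtain ⟨b', hb'⟩ := hg b
      refine ⟨b' * a', ?_⟩
      rw [hS, HopfAlgebra.antipode_mul_antidistrib, ← hS, ha', hb']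
      rfl
  let P : Submodule k (WithConv (H →ₗ[k] H)) :=
    { carrier := {f | ∀ x, f x ∈ LinearMap.range S}
      add_mem' := fun {f g} hf hg x => add_mem (hf x) (hg x)
      zero_mem' := fun x => zero_mem _
      smul_mem' := fun c f hf x => Submodule.smul_mem _ c (hf x) }
  have hSP : ∀ x, (toConv S : WithConv (H →ₗ[k] H)) x ∈ LinearMap.range S := fun x => ⟨x, rfl⟩
  have h1P : (1 : WithConv (H →ₗ[k] H)) ∈ P := fun x => by
    refine ⟨algebraMap k H (Coalgebra.counit x), ?_⟩
    rw [LinearMap.convOne_apply, Algebra.algebraMap_eq_smul_one, map_smul, hS,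
      HopfAlgebra.antipode_one]
  let mulS : P →ₗ[k] P := (LinearMap.mulLeft k (toConv S)).restrict
    (fun f hf => hmul _ f hSP hf)
  have hcancel : (toConv LinearMap.id : WithConv (H →ₗ[k] H)) * toConv S = 1 :=
    LinearMap.id_mul_antipode
  have hcancel' : toConv S * (toConv LinearMap.id : WithConv (H →ₗ[k] H)) = 1 :=
    LinearMap.antipode_mul_id
  have hinj : Function.Injective mulS := by
    intro f g hfg
    have : toConv S * f.1 = toConv S * g.1 := congrArg Subtype.val hfg
    apply Subtype.ext
    rw [← one_mul f.1, ← one_mul g.1, ← hcancel, mul_assoc, mul_assoc, this]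
  have : FiniteDimensional k (WithConv (H →ₗ[k] H)) :=
    Module.Finite.equiv (WithConv.linearEquiv k (H →ₗ[k] H)).symm
  obtain ⟨f, hf⟩ := (LinearMap.injective_iff_surjective.mp hinj) ⟨1, h1P⟩
  have hf1 : toConv S * f.1 = 1 := congrArg Subtype.val hf
  have hid : f.1 = toConv LinearMap.id := by
    rw [← one_mul f.1, ← hcancel, mul_assoc, hf1, mul_one]
  intro x
  have := f.2 x
  rw [hid] at this
  exact this

theorem antipode_injective [FiniteDimensional k H] :
    Function.Injective (HopfAlgebra.antipode k (A := H)) :=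
  LinearMap.injective_iff_surjective.mpr antipode_surjective

end Antipode

section Rep

variable {k : Type*} [Field k] {A : Type*} [Ring A] [Algebra k A]
  {N : Type*} [AddCommGroup N] [Module k N]

/-- The `A`-module given by an algebra map `A → End N`. -/
def Rep (_φ : A →ₐ[k] Module.End k N) : Type _ := N

variable (φ : A →ₐ[k] Module.End k N)

instance : AddCommGroup (Rep φ) := inferInstanceAs (AddCommGroup N)
instance : Module k (Rep φ) := inferInstanceAs (Module k N)
instance [FiniteDimensional k N] : FiniteDimensional k (Rep φ) :=
  inferInstanceAs (FiniteDimensional k N)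

/-- The identity map onto `Rep φ`. -/
def Rep.of : N ≃ₗ[k] Rep φ := LinearEquiv.refl k N

instance : Module A (Rep φ) where
  smul a x := φ a x
  one_smul x := by change φ 1 x = x; rw [map_one]; rfl
  mul_smul a b x := by change φ (a * b) x = φ a (φ b x); rw [map_mul]; rfl
  smul_zero a := by change φ a 0 = 0; exact map_zero _
  smul_add a x y := (φ a).map_add x y
  add_smul a b x := by change φ (a + b) x = φ a x + φ b x; rw [map_add]; rfl
  zero_smul x := by change φ 0 x = 0; rw [map_zero]; rfl

theorem Rep.smul_of (a : A) (x : N) : a • Rep.of φ x = Rep.of φ (φ a x) := rfl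

instance : IsScalarTower k A (Rep φ) where
  smul_assoc c a x := by
    change φ (c • a) x = c • φ a x
    rw [map_smul]; rfl

end Rep

section Tau

variable {k : Type*} [Field k] {H : Type*} [Ring H] [Algebra k H] [FiniteDimensional k H]
  (A : Subalgebra k H)
  (N : Type*) [AddCommGroup N] [Module k N] [Module A N] [IsScalarTower k A N]

instance instFin [FiniteDimensional k N] : FiniteDimensional k (H →ₗ[A] N) :=
  Module.Finite.of_injective
    (LinearMap.restrictScalarsₗ k A H N k) (LinearMap.restrictScalars_injective k)

/-- `dim Hom_A(H, N)`. -/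
def tau : ℕ := Module.finrank k (H →ₗ[A] N)

variable {N} {NA : Type*} [AddCommGroup NA] [Module k NA] [Module A NA] [IsScalarTower k A NA]
  {NB : Type*} [AddCommGroup NB] [Module k NB] [Module A NB] [IsScalarTower k A NB]

/-- postcomposition as a `k`-linear map -/
def postcomp (f : N →ₗ[A] NA) : (H →ₗ[A] N) →ₗ[k] (H →ₗ[A] NA) where
  toFun g := f ∘ₗ g
  map_add' g g' := by ext; simp
  map_smul' c g := by ext x; simp [LinearMap.map_smul_of_tower]

theorem tau_exact [FiniteDimensional k N] [FiniteDimensional k NA] [FiniteDimensional k NB]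
    (i : NA →ₗ[A] N) (p : N →ₗ[A] NB) (hi : Function.Injective i)
    (hip : LinearMap.ker p ≤ LinearMap.range i) :
    tau (k := k) A N ≤ tau (k := k) A NA + tau (k := k) A NB := by
  have h1 := LinearMap.finrank_range_add_finrank_ker (postcomp (k := k) A p)
  have h2 : Module.finrank k (LinearMap.range (postcomp (k := k) A p)) ≤ tau (k := k) A NB :=
    Submodule.finrank_le _
  have h3 : LinearMap.ker (postcomp (k := k) A p) ≤ LinearMap.range (postcomp (k := k) A i) := by
    intro g hg
    have hg' : ∀ x, p (g x) = 0 := fun x => LinearMap.congr_fun (LinearMap.mem_ker.mp hg) x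
    let e := LinearEquiv.ofInjective i hi
    have hm : ∀ x, g x ∈ LinearMap.range i := fun x => hip (LinearMap.mem_ker.mpr (hg' x))
    refine ⟨e.symm.toLinearMap ∘ₗ g.codRestrict (LinearMap.range i) hm, ?_⟩
    ext x
    have := congrArg Subtype.val (e.apply_symm_apply ⟨g x, hm x⟩)
    exact this
  have h4 := Submodule.finrank_mono h3
  have h5 := LinearMap.finrank_range_le (postcomp (k := k) A i)
  unfold tau at *
  omega

theorem tau_congr [FiniteDimensional k N] [FiniteDimensional k NA] (e : N ≃ₗ[A] NA) :
    tau (k := k) A N = tau (k := k) A NA := by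
  refine LinearEquiv.finrank_eq (LinearEquiv.ofLinearMap (postcomp (k := k) A e.toLinearMap)
    (postcomp (k := k) A e.symm.toLinearMap) ?_ ?_)
  · ext; simp [postcomp]
  · ext; simp [postcomp]

theorem tau_pi {ι : Type*} [Fintype ι] [FiniteDimensional k N] :
    tau (k := k) A (ι → N) = Fintype.card ι * tau (k := k) A N := by
  unfold tau
  have e : (H →ₗ[A] (ι → N)) ≃ₗ[k] (ι → (H →ₗ[A] N)) :=
    { toFun := fun f i => LinearMap.proj i ∘ₗ f
      invFun := fun g => LinearMap.pi g
      map_add' := fun f g => by ext; simp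
      map_smul' := fun c f => by ext; simp
      left_inv := fun f => by ext; simp
      right_inv := fun g => by ext; simp }
  rw [e.finrank_eq, Module.finrank_pi_fintype]
  simp

theorem finrank_exact [FiniteDimensional k N] [FiniteDimensional k NA] [FiniteDimensional k NB]
    (i : NA →ₗ[A] N) (p : N →ₗ[A] NB) (hi : Function.Injective i) (hp : Function.Surjective p)
    (hip : LinearMap.ker p = LinearMap.range i) :
    Module.finrank k N = Module.finrank k NA + Module.finrank k NB := by
  have h1 := LinearMap.finrank_range_add_finrank_ker (p.restrictScalars k)
  have h2 := LinearMap.finrank_range_of_inj (f := i.restrictScalars k) hi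
  have h3 : LinearMap.ker (p.restrictScalars k) = LinearMap.range (i.restrictScalars k) := by
    ext x
    exact (SetLike.ext_iff.mp hip x)
  have h4 : Module.finrank k (LinearMap.range (p.restrictScalars k)) = Module.finrank k NB := by
    rw [LinearMap.range_eq_top.mpr (by exact hp), finrank_top]
  rw [h3] at h1
  omega

theorem finite_quot [FiniteDimensional k N] (R : Submodule A N) : FiniteDimensional k (N ⧸ R) :=
  Module.Finite.of_surjective ((R.mkQ).restrictScalars k) (Submodule.mkQ_surjective R)

theorem finite_sub [FiniteDimensional k N] (R : Submodule A N) : FiniteDimensional k R :=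
  Module.Finite.of_injective ((R.subtype).restrictScalars k) R.subtype_injective

/-- The bound on all modules from the bound on cyclic modules. -/
theorem tau_bound (p q : ℕ)
    (h : ∀ I : Submodule A A, q * tau (k := k) A (A ⧸ I) ≤ p * Module.finrank k (A ⧸ I)) :
    ∀ (n : ℕ) (N : Type*) [AddCommGroup N] [Module k N] [Module A N] [IsScalarTower k A N]
    [FiniteDimensional k N], Module.finrank k N = n →
      q * tau (k := k) A N ≤ p * Module.finrank k N := by
  intro n
  induction n using Nat.strong_induction_on with
  | _ n ih =>
  intro N _ _ _ _ _ hn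
  rcases Nat.eq_zero_or_pos n with h0 | hpos
  · have hs : Subsingleton N := Module.finrank_zero_iff.mp (hn.trans h0)
    have : tau (k := k) A N = 0 := by
      have : Subsingleton (H →ₗ[A] N) := ⟨fun f g => by ext; exact Subsingleton.elim _ _⟩
      exact Module.finrank_zero_of_subsingleton
    simp [this]
  · have : Nontrivial N := Module.nontrivial_of_finrank_pos (R := k) (hn ▸ hpos)
    obtain ⟨x, hx⟩ := exists_ne (0 : N)
    let f : A →ₗ[A] N := LinearMap.toSpanSingleton A N x
    let R : Submodule A N := LinearMap.range f
    have := finite_sub (k := k) A R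
    have := finite_quot (k := k) A R
    have : FiniteDimensional k (A ⧸ LinearMap.ker f) := finite_quot (k := k) A (LinearMap.ker f)
    let e : (A ⧸ LinearMap.ker f) ≃ₗ[A] R := LinearMap.quotKerEquivRange f
    have ht := tau_congr (k := k) A e
    have hd := (e.restrictScalars k).finrank_eq
    have hb := h (LinearMap.ker f)
    have h1 := tau_exact (k := k) A R.subtype R.mkQ R.subtype_injective (by simp)
    have h2 := finrank_exact (k := k) A R.subtype R.mkQ R.subtype_injective
      (Submodule.mkQ_surjective R) (by simp)
    have hRpos : 0 < Module.finrank k R := by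
      have : Nontrivial R := ⟨⟨x, 1, by simp [f]⟩, 0, fun hh => hx (congrArg Subtype.val hh)⟩
      exact Module.finrank_pos
    have h3 := ih (Module.finrank k (N ⧸ R)) (by omega) (N ⧸ R) rfl
    rw [ht, hd] at hb
    calc q * tau (k := k) A N ≤ q * (tau (k := k) A R + tau (k := k) A (N ⧸ R)) :=
          Nat.mul_le_mul_left _ h1
      _ = q * tau (k := k) A R + q * tau (k := k) A (N ⧸ R) := by ring
      _ ≤ p * Module.finrank k R + p * Module.finrank k (N ⧸ R) := add_le_add hb h3
      _ = p * Module.finrank k N := by rw [h2]; ring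

end Tau

end CoidealFree

namespace CoidealFree

set_option linter.unusedSectionVars false

section Max

variable {k : Type*} [Field k] {H : Type*} [Ring H] [Algebra k H] [FiniteDimensional k H]
  (A : Subalgebra k H) (p q : ℕ)
  {N : Type*} [AddCommGroup N] [Module k N] [Module A N] [IsScalarTower k A N]
  {NA : Type*} [AddCommGroup NA] [Module k NA] [Module A NA] [IsScalarTower k A NA]
  [FiniteDimensional k N] [FiniteDimensional k NA]

theorem max_sub
    (h : ∀ I : Submodule A A, q * tau (k := k) A (A ⧸ I) ≤ p * Module.finrank k (A ⧸ I))
    (i : NA →ₗ[A] N) (hi : Function.Injective i)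
    (hN : q * tau (k := k) A N = p * Module.finrank k N) :
    q * tau (k := k) A NA = p * Module.finrank k NA := by
  have := finite_quot (k := k) A (LinearMap.range i)
  have h1 := tau_exact (k := k) A i (LinearMap.range i).mkQ hi (by simp)
  have h2 := finrank_exact (k := k) A i (LinearMap.range i).mkQ hi
      (Submodule.mkQ_surjective _) (by simp)
  have h3 := tau_bound (k := k) A p q h _ (N ⧸ LinearMap.range i) rfl
  have h4 := tau_bound (k := k) A p q h _ NA rfl
  have h5 := Nat.mul_le_mul_left q h1
  rw [hN, h2, mul_add, mul_add] at h5
  omega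

theorem max_quot
    (h : ∀ I : Submodule A A, q * tau (k := k) A (A ⧸ I) ≤ p * Module.finrank k (A ⧸ I))
    (f : N →ₗ[A] NA) (hf : Function.Surjective f)
    (hN : q * tau (k := k) A N = p * Module.finrank k N) :
    q * tau (k := k) A NA = p * Module.finrank k NA := by
  have := finite_sub (k := k) A (LinearMap.ker f)
  have h1 := tau_exact (k := k) A (LinearMap.ker f).subtype f
    (LinearMap.ker f).subtype_injective (by simp)
  have h2 := finrank_exact (k := k) A (LinearMap.ker f).subtype f
    (LinearMap.ker f).subtype_injective hf (by simp)
  have h3 := tau_bound (k := k) A p q h _ (LinearMap.ker f) rfl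
  have h4 := tau_bound (k := k) A p q h _ NA rfl
  have h5 := Nat.mul_le_mul_left q h1
  rw [hN, h2, mul_add, mul_add] at h5
  omega

end Max

section DualA

variable {k : Type*} [Field k] {H : Type*} [Ring H] [Algebra k H] [FiniteDimensional k H]
  (A : Subalgebra k H)

/-- The left `A`-module structure on the dual of `A`. -/
def dualRep : A →ₐ[k] Module.End k (Module.Dual k A) :=
  AlgHom.ofLinearMap
    { toFun := fun a => (LinearMap.mulRight k a).dualMap
      map_add' := fun a b => by ext; simp [mul_add]
      map_smul' := fun c a => by ext; simp }
    (by ext; simp) (fun a b => by ext; simp [mul_assoc])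

theorem dualRep_apply (a : A) (f : Module.Dual k A) (b : A) : dualRep A a f b = f (b * a) := rfl

theorem tau_dual : tau (k := k) A (Rep (dualRep A)) = Module.finrank k H := by
  rw [← Subspace.dual_finrank_eq (K := k) (V := H)]
  refine LinearEquiv.finrank_eq
    { toFun := fun f =>
        (Module.Dual.eval k A 1) ∘ₗ (Rep.of (dualRep A)).symm.toLinearMap ∘ₗ f.restrictScalars k
      map_add' := fun f g => by ext; simp
      map_smul' := fun c f => by ext; simp
      invFun := fun g =>
        { toFun := fun x => Rep.of (dualRep A)
            (g ∘ₗ LinearMap.mulRight k x ∘ₗ A.val.toLinearMap)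
          map_add' := fun x y => by
            rw [← map_add]; congr 1; ext a; simp [mul_add]
          map_smul' := fun b x => by
            rw [RingHom.id_apply, Rep.smul_of]; congr 1; ext a
            rw [dualRep_apply]
            simp [Subalgebra.smul_def, mul_assoc] }
      left_inv := fun f => by
        ext x
        apply (Rep.of (dualRep A)).symm.injective
        ext a
        change (Rep.of (dualRep A)).symm (f (a * x)) 1 = (Rep.of (dualRep A)).symm (f x) a
        have := f.map_smul a x
        rw [Subalgebra.smul_def, smul_eq_mul] at this
        rw [this]
        change (Rep.of (dualRep A)).symm (f x) (1 * a) = _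
        rw [one_mul]
      right_inv := fun g => by
        ext x
        change g (((1 : A) : H) * x) = g x
        simp }

variable {N : Type*} [AddCommGroup N] [Module k N] [Module A N] [IsScalarTower k A N]
  [FiniteDimensional k N]

/-- the map from a power of a faithful module onto `A^*` -/
def toDual {ι : Type*} [Fintype ι] (ξ : ι → Module.Dual k N) :
    (ι → N) →ₗ[A] Rep (dualRep A) where
  toFun x := Rep.of (dualRep A)
    (∑ i, ξ i ∘ₗ (LinearMap.toSpanSingleton A N (x i)).restrictScalars k)
  map_add' x y := by
    rw [← map_add, ← Finset.sum_add_distrib]; congr 1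
    ext a; simp
  map_smul' b x := by
    rw [RingHom.id_apply, Rep.smul_of]; congr 1
    ext a
    rw [dualRep_apply]
    simp [mul_smul]

theorem toDual_surjective {ι : Type*} [Fintype ι] (ξ : Module.Basis ι k (Module.Dual k N))
    (hf : ∀ a : A, (∀ x : N, a • x = 0) → a = 0) :
    Function.Surjective (toDual A (fun i => ξ i) : (ι → N) →ₗ[A] Rep (dualRep A)) := by
  classical
  let R : Submodule k (Module.Dual k A) :=
    LinearMap.range ((Rep.of (dualRep A)).symm.toLinearMap ∘ₗ
      (toDual A (fun i => ξ i) : (ι → N) →ₗ[A] Rep (dualRep A)).restrictScalars k)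
  have hR : R.dualCoannihilator = ⊥ := by
    rw [eq_bot_iff]
    intro a ha
    rw [Submodule.mem_dualCoannihilator] at ha
    rw [Submodule.mem_bot]
    apply hf
    intro x
    rw [← Module.forall_dual_apply_eq_zero_iff k]
    intro η
    rw [← ξ.sum_repr η]
    simp only [LinearMap.sum_apply, LinearMap.smul_apply]
    refine Finset.sum_eq_zero fun i _ => ?_
    have := ha _ ⟨Pi.single i x, rfl⟩
    change (∑ j, ξ j ∘ₗ (LinearMap.toSpanSingleton A N
      ((Pi.single i x : ι → N) j)).restrictScalars k) a = 0 at this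
    rw [LinearMap.sum_apply, Finset.sum_eq_single i] at this
    · simp at this
      simp [this]
    · intro j _ hj
      simp [Pi.single_eq_of_ne hj]
    · simp
  have hR' : R = ⊤ := by
    rw [← Subspace.dualCoannihilator_dualAnnihilator_eq (W := R), hR]
    simp
  intro f
  have : (Rep.of (dualRep A)).symm f ∈ R := hR' ▸ Submodule.mem_top
  obtain ⟨x, hx⟩ := this
  exact ⟨x, (Rep.of (dualRep A)).symm.injective hx⟩

theorem max_dual (p q : ℕ)
    (h : ∀ I : Submodule A A, q * tau (k := k) A (A ⧸ I) ≤ p * Module.finrank k (A ⧸ I))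
    (hf : ∀ a : A, (∀ x : N, a • x = 0) → a = 0)
    (hN : q * tau (k := k) A N = p * Module.finrank k N) :
    q * Module.finrank k H = p * Module.finrank k A := by
  have hq := max_quot (k := k) A p q h _
    (toDual_surjective A (Module.finBasis k (Module.Dual k N)) hf) (by
      rw [tau_pi, Module.finrank_pi_fintype]
      simp only [Finset.sum_const, Finset.card_univ, smul_eq_mul]
      rw [mul_left_comm, hN, mul_left_comm])
  rw [tau_dual] at hq
  rw [hq]
  congr 1
  rw [(Rep.of (dualRep A)).symm.finrank_eq]
  exact Subspace.dual_finrank_eq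

end DualA

section Eps

variable {k : Type*} [Field k] {H : Type*} [Ring H] [Bialgebra k H] [FiniteDimensional k H]
  (A : Subalgebra k H)

/-- The trivial module. -/
def epsRep : A →ₐ[k] Module.End k k :=
  (Algebra.lmul k k).comp ((Bialgebra.counitAlgHom k H).comp A.val)

theorem epsRep_apply (a : A) (x : k) : epsRep A a x = Coalgebra.counit (R := k) (a : H) * x := rfl

/-- `k → A^*` -/
def epsToDual : Rep (epsRep A) →ₗ[A] Rep (dualRep A) where
  toFun x := Rep.of (dualRep A) ((show k from x) • (Coalgebra.counit ∘ₗ A.val.toLinearMap))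
  map_add' x y := by
    rw [← map_add]; congr 1; exact add_smul _ _ _
  map_smul' a x := by
    rw [RingHom.id_apply, Rep.smul_of]; congr 1
    ext b
    rw [dualRep_apply]
    change (Coalgebra.counit (R := k) (a : H) * (show k from x)) * Coalgebra.counit (b : H) =
      (show k from x) * Coalgebra.counit ((b : H) * (a : H))
    rw [Bialgebra.counit_mul]
    ring

theorem epsToDual_injective : Function.Injective (epsToDual A) := by
  intro x y hxy
  have : (show k from x) * Coalgebra.counit (R := k) (((1 : A) : H)) =
    (show k from y) * Coalgebra.counit (R := k) (((1 : A) : H)) :=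
    LinearMap.congr_fun ((Rep.of (dualRep A)).injective hxy) (1 : A)
  have h1 : Coalgebra.counit (R := k) (((1 : A) : H)) = 1 := Bialgebra.counit_one
  rw [h1] at this
  exact mul_right_cancel₀ (M₀ := k) one_ne_zero this

theorem tau_eps (W : Submodule k H)
    (hW : W = Submodule.span k
      {z : H | ∃ a ∈ A, ∃ h : H, Coalgebra.counit (R := k) a = 0 ∧ z = a * h}) :
    tau (k := k) A (Rep (epsRep A)) = Module.finrank k (H ⧸ W) := by
  rw [← Subspace.dual_finrank_eq (K := k) (V := H ⧸ W)]
  rw [(Submodule.dualQuotEquivDualAnnihilator W).finrank_eq]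
  have key : ∀ g : Module.Dual k H, g ∈ W.dualAnnihilator ↔
      ∀ (a : A) (x : H), g (a * x) = Coalgebra.counit (R := k) (a : H) * g x := by
    intro g
    rw [Submodule.mem_dualAnnihilator]
    constructor
    · intro hg a x
      have := hg (((a : H) - algebraMap k H (Coalgebra.counit (R := k) (a : H))) * x) (by
        rw [hW]
        refine Submodule.subset_span ⟨_, sub_mem a.2 (A.algebraMap_mem _), x, ?_, rfl⟩
        simp)
      rw [sub_mul, map_sub, sub_eq_zero] at this
      rw [this, ← Algebra.smul_def, map_smul, smul_eq_mul]
    · intro hg w hw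
      rw [hW] at hw
      induction hw using Submodule.span_induction with
      | mem z hz =>
        obtain ⟨a, ha, y, h0, rfl⟩ := hz
        have := hg ⟨a, ha⟩ y
        rw [this, h0, zero_mul]
      | zero => simp
      | add x y _ _ hx hy => rw [map_add, hx, hy, add_zero]
      | smul c x _ hx => rw [map_smul, hx, smul_zero]
  refine LinearEquiv.finrank_eq
    { toFun := fun f => ⟨(Rep.of (epsRep A)).symm.toLinearMap ∘ₗ f.restrictScalars k, by
        rw [key]
        intro a x
        have := f.map_smul a x
        rw [Subalgebra.smul_def, smul_eq_mul] at this
        change (Rep.of (epsRep A)).symm (f _) = _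
        rw [this]
        rfl⟩
      map_add' := fun f g => by ext; simp
      map_smul' := fun c f => by ext; simp
      invFun := fun g =>
        { toFun := fun x => Rep.of (epsRep A) (g.1 x)
          map_add' := fun x y => by simp
          map_smul' := fun b x => by
            rw [RingHom.id_apply, Rep.smul_of, epsRep_apply, ← (key g.1).mp g.2]
            rfl }
      left_inv := fun f => rfl
      right_inv := fun g => rfl }

end Eps

end CoidealFree

namespace CoidealFree

set_option linter.unusedSectionVars false

section Twist

variable {k : Type*} [Field k] {H : Type*} [Ring H] [HopfAlgebra k H]
  (A : Subalgebra k H)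

/-- inclusion `A ⊗ H → H ⊗ H` -/
def incl : (A ⊗[k] H) →ₐ[k] (H ⊗[k] H) := Algebra.TensorProduct.map A.val (AlgHom.id k H)

theorem incl_tmul (a : A) (x : H) : incl A (a ⊗ₜ[k] x) = (a : H) ⊗ₜ[k] x := rfl

theorem incl_injective : Function.Injective (incl A) := by
  have : Function.Injective ((A.val.toLinearMap).rTensor H) :=
    Module.Flat.rTensor_preserves_injective_linearMap _ Subtype.val_injective
  exact this

theorem comul_mem (hA : IsRightCoidealSubalgebra k A) (a : A) : Bialgebra.comulAlgHom k H (a : H) ∈ (incl A).range := by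
  obtain ⟨t, ht⟩ := hA a a.2
  exact ⟨t, ht⟩

variable (hA : IsRightCoidealSubalgebra k A)

/-- The coaction `A → A ⊗ H`. -/
def coact : A →ₐ[k] (A ⊗[k] H) :=
  ((AlgEquiv.ofInjective (incl A) (incl_injective A)).symm : (incl A).range →ₐ[k] (A ⊗[k] H)).comp
    (((Bialgebra.comulAlgHom k H).comp A.val).codRestrict (incl A).range (comul_mem A hA))

theorem incl_coact (a : A) : incl A (coact A hA a) = Coalgebra.comul (R := k) (a : H) := by
  have := congrArg Subtype.val ((AlgEquiv.ofInjective (incl A) (incl_injective A)).apply_symm_apply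
    ((((Bialgebra.comulAlgHom k H).comp A.val).codRestrict (incl A).range (comul_mem A hA)) a))
  exact this

/-- right multiplication by the antipode -/
def rightS : H →ₐ[k] Module.End k H :=
  AlgHom.ofLinearMap
    { toFun := fun a => LinearMap.mulRight k (HopfAlgebra.antipode k a)
      map_add' := fun a b => by ext; simp [mul_add]
      map_smul' := fun c a => by ext; simp }
    (by ext; simp) (fun a b => by ext; simp [mul_assoc, HopfAlgebra.antipode_mul_antidistrib])

theorem rightS_apply (a u : H) : rightS (k := k) a u = u * HopfAlgebra.antipode k a := rfl

variable (N : Type*) [AddCommGroup N] [Module k N] [Module A N] [IsScalarTower k A N]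

/-- `A ⊗ H` acts on `N ⊗ H`. -/
def twAct : (A ⊗[k] H) →ₐ[k] Module.End k (N ⊗[k] H) :=
  (Module.endTensorEndAlgHom (R := k) (S := k) (A := k) (M := N) (N := H)).comp
    (Algebra.TensorProduct.map (Algebra.lsmul k k N) rightS)

theorem twAct_tmul (a : A) (x : H) (n : N) (u : H) :
    twAct A N (a ⊗ₜ[k] x) (n ⊗ₜ[k] u) = (a • n) ⊗ₜ[k] (u * HopfAlgebra.antipode k x) := rfl

/-- The twisted module structure. -/
def twRep : A →ₐ[k] Module.End k (N ⊗[k] H) := (twAct A N).comp (coact A hA)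

variable {N}

theorem twAct_key (f : H →ₗ[A] N) (u : H) (t : A ⊗[k] H) (s : H ⊗[k] H) :
    TensorProduct.map (f.restrictScalars k) (LinearMap.mulLeft k u ∘ₗ HopfAlgebra.antipode k)
      (incl A t * s) =
    twAct A N t (TensorProduct.map (f.restrictScalars k)
      (LinearMap.mulLeft k u ∘ₗ HopfAlgebra.antipode k) s) := by
  induction t using TensorProduct.induction_on with
  | zero => simp
  | add a b ha hb => simp only [map_add, add_mul, LinearMap.add_apply, ha, hb]
  | tmul a x =>
    induction s using TensorProduct.induction_on with
    | zero => simp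
    | add a b ha hb => simp only [map_add, mul_add, ha, hb]
    | tmul y z =>
      rw [incl_tmul, Algebra.TensorProduct.tmul_mul_tmul, TensorProduct.map_tmul,
        TensorProduct.map_tmul, twAct_tmul]
      have := f.map_smul a y
      rw [Subalgebra.smul_def, smul_eq_mul] at this
      simp [this, HopfAlgebra.antipode_mul_antidistrib, mul_assoc]

/-- `f ⊗ u ↦ (m ↦ f(m₁) ⊗ u S(m₂))` -/
def twHom (f : H →ₗ[A] N) (u : H) : H →ₗ[A] Rep (twRep A hA N) where
  toFun m := Rep.of (twRep A hA N) (TensorProduct.map (f.restrictScalars k)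
    (LinearMap.mulLeft k u ∘ₗ HopfAlgebra.antipode k) (Coalgebra.comul (R := k) m))
  map_add' x y := by simp
  map_smul' a x := by
    rw [RingHom.id_apply, Rep.smul_of]; congr 1
    rw [Subalgebra.smul_def, smul_eq_mul, Bialgebra.comul_mul, ← incl_coact A hA, twAct_key]
    rfl

/-- right multiplication `(N ⊗ H) ⊗ H → N ⊗ H` -/
def rmul : (N ⊗[k] H) ⊗[k] H →ₗ[k] N ⊗[k] H :=
  (LinearMap.mul' k H).lTensor N ∘ₗ (TensorProduct.assoc k N H H).toLinearMap

theorem untwist (f : H →ₗ[A] N) (u m : H) :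
    rmul ((TensorProduct.map (((Rep.of (twRep A hA N)).symm.toLinearMap) ∘ₗ
      (twHom A hA f u).restrictScalars k) LinearMap.id) (Coalgebra.comul (R := k) m)) =
      f m ⊗ₜ[k] u := by
  let F := f.restrictScalars k
  let S := HopfAlgebra.antipode k (A := H)
  let Q : H ⊗[k] (H ⊗[k] H) →ₗ[k] N ⊗[k] H :=
    TensorProduct.map F (LinearMap.mulLeft k u ∘ₗ LinearMap.mul' k H ∘ₗ S.rTensor H)
  have h1 : ∀ s : H ⊗[k] H,
      rmul ((TensorProduct.map (((Rep.of (twRep A hA N)).symm.toLinearMap) ∘ₗ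
      (twHom A hA f u).restrictScalars k) LinearMap.id) s) =
      Q (TensorProduct.assoc k H H H ((Coalgebra.comul (R := k)).rTensor H s)) := by
    intro s
    induction s using TensorProduct.induction_on with
    | zero => simp
    | add a b ha hb => simp only [map_add, ha, hb]
    | tmul a b =>
      rw [TensorProduct.map_tmul, LinearMap.rTensor_tmul]
      change rmul ((TensorProduct.map F (LinearMap.mulLeft k u ∘ₗ S)
        (Coalgebra.comul (R := k) a)) ⊗ₜ[k] b) = _
      induction Coalgebra.comul (R := k) a using TensorProduct.induction_on with
      | zero => simp
      | add a b ha hb => simp only [map_add, ha, hb, TensorProduct.add_tmul]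
      | tmul c d => simp [rmul, Q, mul_assoc]
  rw [h1, Coalgebra.coassoc_apply]
  have h2 : ∀ s : H ⊗[k] H, Q ((Coalgebra.comul (R := k)).lTensor H s) =
      TensorProduct.map F (LinearMap.toSpanSingleton k H u)
        ((Coalgebra.counit (R := k)).lTensor H s) := by
    intro s
    induction s using TensorProduct.induction_on with
    | zero => simp
    | add a b ha hb => simp only [map_add, ha, hb]
    | tmul a b =>
      simp only [LinearMap.lTensor_tmul, Q, TensorProduct.map_tmul, LinearMap.comp_apply, S]
      rw [HopfAlgebra.mul_antipode_rTensor_comul_apply]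
      simp [Algebra.algebraMap_eq_smul_one]
  rw [h2, Coalgebra.lTensor_counit_comul]
  simp [F]

theorem tau_twist_ge [FiniteDimensional k H] [FiniteDimensional k N] :
    Module.finrank k H * tau (k := k) A N ≤ tau (k := k) A (Rep (twRep A hA N)) := by
  let b := Module.finBasis k H
  let L : (Fin (Module.finrank k H) → (H →ₗ[A] N)) →ₗ[k] (H →ₗ[A] Rep (twRep A hA N)) :=
    { toFun := fun f => ∑ i, twHom A hA (f i) (b i)
      map_add' := fun f g => by
        rw [← Finset.sum_add_distrib]
        refine Finset.sum_congr rfl fun i _ => ?_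
        ext m
        exact LinearMap.congr_fun (TensorProduct.map_add_left ((f i).restrictScalars k)
          ((g i).restrictScalars k) (LinearMap.mulLeft k (b i) ∘ₗ HopfAlgebra.antipode k))
          (Coalgebra.comul (R := k) m)
      map_smul' := fun c f => by
        rw [RingHom.id_apply, Finset.smul_sum]
        refine Finset.sum_congr rfl fun i _ => ?_
        ext m
        exact LinearMap.congr_fun (TensorProduct.map_smul_left c ((f i).restrictScalars k)
          (LinearMap.mulLeft k (b i) ∘ₗ HopfAlgebra.antipode k))
          (Coalgebra.comul (R := k) m) }
  have hL : Function.Injective L := by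
    rw [injective_iff_map_eq_zero]
    intro f hf
    have hf0 : ∑ i, twHom A hA (f i) (b i) = 0 := hf
    have h0 : ∀ m : H, ∑ i, f i m ⊗ₜ[k] b i = 0 := by
      intro m
      have : ∑ i, rmul ((TensorProduct.map (((Rep.of (twRep A hA N)).symm.toLinearMap) ∘ₗ
          (twHom A hA (f i) (b i)).restrictScalars k) LinearMap.id)
          (Coalgebra.comul (R := k) m)) = 0 := by
        have hg : ∀ s : H ⊗[k] H,
          ∑ i, rmul ((TensorProduct.map (((Rep.of (twRep A hA N)).symm.toLinearMap) ∘ₗ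
          (twHom A hA (f i) (b i)).restrictScalars k) LinearMap.id) s) = 0 := by
          intro s
          induction s using TensorProduct.induction_on with
          | zero => simp
          | add a b ha hb => simp only [map_add, Finset.sum_add_distrib, ha, hb, add_zero]
          | tmul x y =>
            simp only [TensorProduct.map_tmul]
            rw [← map_sum, ← TensorProduct.sum_tmul]
            have hx := LinearMap.congr_fun hf0 x
            rw [LinearMap.sum_apply] at hx
            have hx' := congrArg (Rep.of (twRep A hA N)).symm hx
            rw [map_sum] at hx'
            simp only [LinearMap.comp_apply, LinearEquiv.coe_coe, LinearMap.restrictScalars_apply]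
            rw [hx']
            simp
        exact hg _
      simpa only [untwist] using this
    funext i
    ext m
    have := TensorProduct.sum_tmul_basis_right_eq_zero b
      (Finsupp.equivFunOnFinite.symm (fun i => f i m)) (by
        rw [Finsupp.sum_fintype _ _ (by simp)]
        exact h0 m)
    exact DFunLike.congr_fun this i
  have := LinearMap.finrank_le_finrank_of_injective hL
  rw [Module.finrank_pi_fintype] at this
  simpa [tau] using this

theorem tw_faithful [FiniteDimensional k H] (w : H →ₗ[A] N) (hw : w 1 ≠ 0) (x : A)
    (hx : ∀ z : Rep (twRep A hA N), x • z = 0) : x = 0 := by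
  let S := HopfAlgebra.antipode k (A := H)
  -- Step 1
  have h1 : ∀ n : N, ((LinearMap.toSpanSingleton A N n).restrictScalars k).rTensor H
      (coact A hA x) = 0 := by
    intro n
    have hinj : Function.Injective (S.lTensor N) :=
      Module.Flat.lTensor_preserves_injective_linearMap _ antipode_injective
    apply hinj
    rw [map_zero]
    have hz : twAct A N (coact A hA x) (n ⊗ₜ[k] (1 : H)) = 0 :=
      hx (Rep.of (twRep A hA N) (n ⊗ₜ[k] (1 : H)))
    rw [← hz]
    generalize coact A hA x = t
    induction t using TensorProduct.induction_on with
    | zero => simp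
    | add a b ha hb => simp only [map_add, LinearMap.add_apply, ha, hb]
    | tmul a b => rw [twAct_tmul]; simp [S]
  -- Step 2
  have h2 : ∀ y : H, ((w.restrictScalars k) ∘ₗ LinearMap.mulRight k y).rTensor H
      (Coalgebra.comul (R := k) (x : H)) = 0 := by
    intro y
    rw [← h1 (w y), ← incl_coact A hA]
    generalize coact A hA x = t
    induction t using TensorProduct.induction_on with
    | zero => simp
    | add a b ha hb => simp only [map_add, ha, hb]
    | tmul a b =>
      rw [incl_tmul]
      have := w.map_smul a y
      rw [Subalgebra.smul_def, smul_eq_mul] at this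
      simp [this]
  -- Step 3
  let b := Module.finBasis k H
  obtain ⟨c, hc⟩ := TensorProduct.eq_repr_basis_right b (Coalgebra.comul (R := k) (x : H))
  have h3 : ∀ i y, w (c i * y) = 0 := by
    intro i y
    have := h2 y
    rw [← hc, Finsupp.sum_fintype _ _ (by simp), map_sum] at this
    have := TensorProduct.sum_tmul_basis_right_eq_zero b
      (Finsupp.equivFunOnFinite.symm (fun i => w (c i * y))) (by
        rw [Finsupp.sum_fintype _ _ (by simp)]
        simpa using this)
    exact DFunLike.congr_fun this i
  let W := w.restrictScalars k
  let Z : (H ⊗[k] H) ⊗[k] H →ₗ[k] N ⊗[k] H :=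
    (W ∘ₗ LinearMap.mul' k H ∘ₗ S.lTensor H).rTensor H
  have h4 : Z ((TensorProduct.assoc k H H H).symm ((Coalgebra.comul (R := k)).lTensor H
      (Coalgebra.comul (R := k) (x : H)))) = 0 := by
    rw [← hc, Finsupp.sum_fintype _ _ (by simp), map_sum, map_sum, map_sum]
    refine Finset.sum_eq_zero fun i _ => ?_
    rw [LinearMap.lTensor_tmul]
    induction Coalgebra.comul (R := k) (b i) using TensorProduct.induction_on with
    | zero => simp
    | add a b ha hb => simp only [TensorProduct.tmul_add, map_add, ha, hb, add_zero]
    | tmul y z => simp [Z, W, h3]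
  rw [Coalgebra.coassoc_symm_apply] at h4
  have h5 : ∀ s : H ⊗[k] H, Z ((Coalgebra.comul (R := k)).rTensor H s) =
      TensorProduct.map (LinearMap.toSpanSingleton k N (w 1)) LinearMap.id
        ((Coalgebra.counit (R := k)).rTensor H s) := by
    intro s
    induction s using TensorProduct.induction_on with
    | zero => simp
    | add a b ha hb => simp only [map_add, ha, hb]
    | tmul a b =>
      simp only [LinearMap.rTensor_tmul, Z, LinearMap.comp_apply, S]
      rw [HopfAlgebra.mul_antipode_lTensor_comul_apply]
      rw [Algebra.algebraMap_eq_smul_one, map_smul]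
      simp [W]
  rw [h5, Coalgebra.rTensor_counit_comul] at h4
  simp only [TensorProduct.map_tmul, LinearMap.toSpanSingleton_apply, one_smul,
    LinearMap.id_apply] at h4
  have hinj : Function.Injective ((LinearMap.toSpanSingleton k N (w 1)).rTensor H) :=
    Module.Flat.rTensor_preserves_injective_linearMap _ (by
      intro c d hcd
      exact smul_left_injective k hw hcd)
  have h6 : (1 : k) ⊗ₜ[k] (x : H) = 0 := by
    apply hinj
    simpa using h4
  have h7 := congrArg (TensorProduct.lid k H) h6
  simp at h7
  exact h7

end Twist

/-- The maximal ratio is attained on a cyclic module. -/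
theorem exists_max {k : Type*} [Field k] {H : Type*} [Ring H] [Algebra k H]
    [FiniteDimensional k H] [Nontrivial H] (A : Subalgebra k H) :
    ∃ I₀ : Submodule A A, 0 < Module.finrank k (A ⧸ I₀) ∧ ∀ I : Submodule A A,
      Module.finrank k (A ⧸ I₀) * tau (k := k) A (A ⧸ I) ≤
        tau (k := k) A (A ⧸ I₀) * Module.finrank k (A ⧸ I) := by
  let r : Submodule A A → ℚ := fun I =>
    (tau (k := k) A (A ⧸ I) : ℚ) / (Module.finrank k (A ⧸ I) : ℚ)
  have hfin : (Set.image r {I | 0 < Module.finrank k (A ⧸ I)}).Finite := by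
    have hle : ∀ I : Submodule A A, Module.finrank k (A ⧸ I) ≤ Module.finrank k A := fun I =>
      LinearMap.finrank_le_finrank_of_surjective (f := (I.mkQ).restrictScalars k)
        (Submodule.mkQ_surjective I)
    have hle' : ∀ I : Submodule A A, tau (k := k) A (A ⧸ I) ≤
        Module.finrank k H * Module.finrank k A := fun I => by
      have := finite_quot (k := k) A I
      have h1 := LinearMap.finrank_le_finrank_of_injective
        (f := LinearMap.restrictScalarsₗ k A H (A ⧸ I) k) (LinearMap.restrictScalars_injective k)
      exact (h1.trans (Module.finrank_linearMap k k H (A ⧸ I)).le).trans (Nat.mul_le_mul_left _ (hle I))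
    refine Set.Finite.subset (((Set.finite_Iic (Module.finrank k H * Module.finrank k A)).prod
      (Set.finite_Iic (Module.finrank k A))).image (fun z : ℕ × ℕ => (z.1 : ℚ) / (z.2 : ℚ))) ?_
    rintro _ ⟨I, _, rfl⟩
    exact ⟨(tau (k := k) A (A ⧸ I), Module.finrank k (A ⧸ I)), ⟨hle' I, hle I⟩, rfl⟩
  have hne : (Set.image r {I | 0 < Module.finrank k (A ⧸ I)}).Nonempty := by
    refine ⟨_, ⊥, ?_, rfl⟩
    have := finite_quot (k := k) A (⊥ : Submodule A A)
    have e := ((Submodule.quotEquivOfEqBot (⊥ : Submodule A A) rfl).restrictScalars k).finrank_eq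
    change 0 < Module.finrank k (A ⧸ (⊥ : Submodule A A))
    rw [e]
    exact Module.finrank_pos
  obtain ⟨_, ⟨I₀, hI₀, rfl⟩, hmax⟩ := hfin.exists_maximal hne
  refine ⟨I₀, hI₀, fun I => ?_⟩
  rcases Nat.eq_zero_or_pos (Module.finrank k (A ⧸ I)) with h0 | hpos
  · have := finite_quot (k := k) A I
    have hs : Subsingleton (A ⧸ I) := Module.finrank_zero_iff.mp h0
    have : tau (k := k) A (A ⧸ I) = 0 := by
      have : Subsingleton (H →ₗ[A] (A ⧸ I)) := ⟨fun f g => by ext; exact Subsingleton.elim _ _⟩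
      exact Module.finrank_zero_of_subsingleton
    simp [this]
  · have hle : r I ≤ r I₀ := by
      rcases le_total (r I) (r I₀) with hh | hh
      · exact hh
      · exact hmax ⟨I, hpos, rfl⟩ hh
    have hq : (0 : ℚ) < Module.finrank k (A ⧸ I) := by exact_mod_cast hpos
    have hq0 : (0 : ℚ) < Module.finrank k (A ⧸ I₀) := by exact_mod_cast hI₀
    have := (div_le_div_iff₀ hq hq0).mp hle
    rw [mul_comm]
    exact_mod_cast this

end CoidealFree

/-- **Theorem.** Let `H` be a finite-dimensional Hopf algebra over a field `k` and let `A`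
be a right coideal subalgebra of `H`. Then `dim_k A · dim_k (H/A⁺H) = dim_k H`, where
`A⁺ = A ∩ ker ε` and `A⁺H` is the span of the products `ah` with `a ∈ A⁺`, `h ∈ H`. -/
theorem finrank_coideal_subalgebra_mul_finrank_quotient
    {k : Type*} [Field k] {H : Type*} [Ring H] [HopfAlgebra k H] [FiniteDimensional k H]
    (A : Subalgebra k H) (hA : IsRightCoidealSubalgebra k A)
    (W : Submodule k H)
    (hW : W = Submodule.span k
      {z : H | ∃ a ∈ A, ∃ h : H, Coalgebra.counit (R := k) a = 0 ∧ z = a * h}) :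
    Module.finrank k A * Module.finrank k (H ⧸ W) = Module.finrank k H := by
  have hnt : Nontrivial H := by
    refine ⟨1, 0, fun h => ?_⟩
    have := congrArg (Coalgebra.counit (R := k)) h
    simp at this
  obtain ⟨I₀, hpos, hb⟩ := CoidealFree.exists_max (k := k) A
  have hfin := CoidealFree.finite_quot (k := k) A I₀
  set q := Module.finrank k (A ⧸ I₀) with hq
  set p := CoidealFree.tau (k := k) A (A ⧸ I₀) with hp
  -- `p` is positive
  have hdual := CoidealFree.tau_bound (k := k) A p q hb _
    (CoidealFree.Rep (CoidealFree.dualRep A)) rfl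
  rw [CoidealFree.tau_dual] at hdual
  have hH : 0 < Module.finrank k H := Module.finrank_pos
  have hp0 : 0 < p := by
    rcases Nat.eq_zero_or_pos p with h0 | h0
    · rw [h0, zero_mul] at hdual
      have := Nat.mul_pos hpos hH
      omega
    · exact h0
  have hntH : Nontrivial (H →ₗ[A] (A ⧸ I₀)) := Module.nontrivial_of_finrank_pos (R := k) hp0
  obtain ⟨f, hf⟩ := exists_ne (0 : H →ₗ[A] (A ⧸ I₀))
  obtain ⟨y, hy⟩ : ∃ y, f y ≠ 0 := by
    by_contra! hcon
    exact hf (LinearMap.ext hcon)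
  let w : H →ₗ[A] (A ⧸ I₀) :=
    { toFun := fun x => f (x * y)
      map_add' := fun a b => by rw [add_mul, map_add]
      map_smul' := fun a x => by
        rw [RingHom.id_apply, ← map_smul, smul_mul_assoc] }
  have hw : w 1 ≠ 0 := by
    change f (1 * y) ≠ 0
    rwa [one_mul]
  have htw : q * CoidealFree.tau (k := k) A (CoidealFree.Rep (CoidealFree.twRep A hA (A ⧸ I₀))) =
      p * Module.finrank k (CoidealFree.Rep (CoidealFree.twRep A hA (A ⧸ I₀))) := by
    apply le_antisymm
    · exact CoidealFree.tau_bound (k := k) A p q hb _ _ rfl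
    · have h1 := CoidealFree.tau_twist_ge (k := k) A hA (N := A ⧸ I₀)
      have h2 : Module.finrank k (CoidealFree.Rep (CoidealFree.twRep A hA (A ⧸ I₀))) =
          q * Module.finrank k H :=
        (CoidealFree.Rep.of (CoidealFree.twRep A hA (A ⧸ I₀))).symm.finrank_eq.trans
          (Module.finrank_tensorProduct ..)
      rw [h2, mul_left_comm]
      refine Nat.mul_le_mul_left q ?_
      rw [mul_comm]
      exact h1
  have hfaith := fun x hx => CoidealFree.tw_faithful A hA w hw x hx
  have hmain := CoidealFree.max_dual (k := k) A p q hb hfaith htw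
  -- the trivial module
  have heps := CoidealFree.max_sub (k := k) A p q hb (CoidealFree.epsToDual A)
    (CoidealFree.epsToDual_injective A) (by
      rw [CoidealFree.tau_dual, hmain, ← (CoidealFree.Rep.of (CoidealFree.dualRep A)).finrank_eq]
      congr 1
      exact Subspace.dual_finrank_eq.symm)
  rw [CoidealFree.tau_eps A W hW, ← (CoidealFree.Rep.of (CoidealFree.epsRep A)).finrank_eq,
    Module.finrank_self, mul_one] at heps
  rw [← heps] at hmain
  apply Nat.eq_of_mul_eq_mul_left hpos
  rw [hmain]
  ring

end
end

section
/- Let U and H be finite-dimensional Hopf algebras over a field k, let φ : H → U* be an isomorphism of Hopf algebras, write (h, u) = φ(h)(u) for the induced pairing, and let h ↼ u = (h₍₁₎, u) h₍₂₎ denote the induced right action of U on H. Let A be a right coideal subalgebra of U, set A⁺ = A ∩ ker(ε) and A† = φ⁻¹((U/A⁺U)*), where (U/A⁺U)* is regarded as a subspace of U* via the transpose of the quotient map U → U/A⁺U. If Λ is a nonzero right integral of A (that is, Λ ∈ A, Λ ≠ 0, and Λa = ε(a)Λ for all a ∈ A), then A† = H ↼ Λ := { h ↼ Λ : h ∈ H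 }. -/
open scoped TensorProduct

noncomputable section

/-- Given a pairing `B : H × U → k`, the right action `h ↼ u = (h₍₁₎, u) h₍₂₎` of `U`
on `H`. -/
def rAct (k : Type*) [CommSemiring k] {H U : Type*} [Semiring H] [Semiring U]
    [HopfAlgebra k H] [HopfAlgebra k U] (B : H →ₗ[k] U →ₗ[k] k) (h : H) (u : U) : H :=
  TensorProduct.lift ((LinearMap.lsmul k H).comp (B.flip u)) (Coalgebra.comul (R := k) h)

/-- `B : H × U → k` is a Hopf pairing inducing an isomorphism of Hopf algebras
`φ : H → U*`, `φ(h)(u) = B h u`: it is multiplicative/comultiplicative on both sides,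
unital/counital on both sides, compatible with the antipodes, and the induced map
`H → U* = (U →ₗ[k] k)` is bijective. -/
structure IsHopfPairingIso (k : Type*) [CommSemiring k] {H U : Type*} [Semiring H]
    [Semiring U] [HopfAlgebra k H] [HopfAlgebra k U]
    (B : H →ₗ[k] U →ₗ[k] k) : Prop where
  mul_left : ∀ (h h' : H) (u : U), B (h * h') u =
    LinearMap.mul' k k (TensorProduct.map (B h) (B h') (Coalgebra.comul (R := k) u))
  mul_right : ∀ (h : H) (u u' : U), B h (u * u') =
    LinearMap.mul' k k (TensorProduct.map (B.flip u) (B.flip u') (Coalgebra.comul (R := k) h))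
  one_left : ∀ u : U, B 1 u = Coalgebra.counit (R := k) u
  one_right : ∀ h : H, B h 1 = Coalgebra.counit (R := k) h
  antipode_compat : ∀ (h : H) (u : U),
    B (HopfAlgebra.antipode (R := k) h) u = B h (HopfAlgebra.antipode (R := k) u)
  bijective : Function.Bijective (⇑B)

end

noncomputable section

section antipode
open LinearMap WithConv HopfAlgebra Coalgebra
variable {k U : Type*} [Field k] [Ring U] [HopfAlgebra k U]

/-- Sandwiching by elements of the first tensor factor commutes with `id ⊗ F`. -/
lemma lT_sandwich (F : U →ₗ[k] U) (x y p : U) :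
    F.lTensor U ((x ⊗ₜ[k] (1:U)) * ((1:U) ⊗ₜ[k] p) * (y ⊗ₜ[k] (1:U))) =
      (x ⊗ₜ[k] (1:U)) * ((1:U) ⊗ₜ[k] F p) * (y ⊗ₜ[k] (1:U)) := by
  simp

/-- first inclusion -/
abbrev iL : U →ₐ[k] U ⊗[k] U := Algebra.TensorProduct.includeLeft
/-- second inclusion -/
abbrev iR : U →ₐ[k] U ⊗[k] U := Algebra.TensorProduct.includeRight

/-- postcomposition on convolution algebras -/
abbrev cv {C D : Type*} [AddCommGroup C] [AddCommGroup D] [Module k C] [Module k D]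
    (f : C →ₗ[k] D) (g : WithConv (U →ₗ[k] C)) : WithConv (U →ₗ[k] D) :=
  toConv (f ∘ₗ g.ofConv)

lemma cv_mul {C D : Type*} [Ring C] [Ring D] [Algebra k C] [Algebra k D]
    (f : C →ₐ[k] D) (g h : WithConv (U →ₗ[k] C)) :
    cv f.toLinearMap (g * h) = cv f.toLinearMap g * cv f.toLinearMap h := by
  unfold cv
  rw [algHom_comp_convMul_distrib]

lemma cv_one {C D : Type*} [Ring C] [Ring D] [Algebra k C] [Algebra k D]
    (f : C →ₐ[k] D) :
    cv (U := U) f.toLinearMap 1 = 1 := by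
  ext u
  simp [LinearMap.convOne_def]

abbrev idc : WithConv (U →ₗ[k] U) := toConv LinearMap.id
abbrev Sc : WithConv (U →ₗ[k] U) := toConv (antipode k)

lemma comul_eq_conv :
    cv (comul (R := k) (A := U)) idc = cv iL.toLinearMap idc * cv iR.toLinearMap idc := by
  ext u
  simp only [convMul_apply]
  show comul u = _
  induction comul (R := k) u with
  | zero => simp
  | tmul x y => simp
  | add x y hx hy => rw [map_add, map_add, ← hx, ← hy]

lemma comul_alg_cv (g : WithConv (U →ₗ[k] U)) :
    cv (comul (R := k) (A := U)) g = cv (Bialgebra.comulAlgHom k U).toLinearMap g := rfl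

lemma antipode_comul :
    cv (comul (R := k) (A := U)) Sc = cv iR.toLinearMap Sc * cv iL.toLinearMap Sc := by
  have h1 : cv (comul (R := k) (A := U)) Sc * cv (comul (R := k) (A := U)) idc = 1 := by
    rw [comul_alg_cv, comul_alg_cv, ← cv_mul, antipode_mul_id, cv_one]
  have h2 : cv (comul (R := k) (A := U)) idc *
      (cv iR.toLinearMap Sc * cv iL.toLinearMap Sc) = 1 := by
    rw [comul_eq_conv]
    calc _ = cv iL.toLinearMap idc * (cv iR.toLinearMap idc *
      cv iR.toLinearMap Sc) * cv iL.toLinearMap Sc := by simp only [mul_assoc]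
      _ = _ := by
        rw [← cv_mul, id_mul_antipode, cv_one, mul_one, ← cv_mul, id_mul_antipode, cv_one]
  exact left_inv_eq_right_inv h1 h2


lemma antipode_comul_comp (p : U →ₗ[k] U)
    (hp : comul ∘ₗ p = TensorProduct.map p p ∘ₗ comul (R := k)) :
    cv (comul (R := k) (A := U)) (toConv (antipode k ∘ₗ p)) =
      cv iR.toLinearMap (toConv (antipode k ∘ₗ p)) *
        cv iL.toLinearMap (toConv (antipode k ∘ₗ p)) := by
  ext u
  have h := congrArg (fun f => f.ofConv (p u)) (antipode_comul (k := k) (U := U))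
  have h2 := LinearMap.congr_fun hp u
  simp only [LinearMap.comp_apply] at h2
  simp only [LinearMap.convMul_def, LinearMap.comp_apply, h2] at h
  simp only [LinearMap.convMul_apply]
  refine h.trans ?_
  rw [← LinearMap.comp_apply (TensorProduct.map _ _), ← TensorProduct.map_comp]
  rfl

lemma antipode_comul_apply (u : U) : comul (R := k) (antipode k u) =
    TensorProduct.comm k U U (TensorProduct.map (antipode k) (antipode k) (comul u)) := by
  have h := congrArg (fun f => f.ofConv u) (antipode_comul (k := k) (U := U))
  simp only [LinearMap.convMul_def, LinearMap.comp_apply] at h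
  refine h.trans ?_
  clear h
  induction comul (R := k) u with
  | zero => simp
  | tmul x y => simp
  | add x y hx hy => simp only [map_add, hx, hy]

lemma exists_gen_inv {V W : Type*} [AddCommGroup V] [Module k V] [AddCommGroup W] [Module k W]
    (f : V →ₗ[k] W) : ∃ g : W →ₗ[k] V, f ∘ₗ g ∘ₗ f = f := by
  obtain ⟨s, hs⟩ := f.rangeRestrict.exists_rightInverse_of_surjective f.range_rangeRestrict
  obtain ⟨g, hg⟩ := LinearMap.exists_extend s
  refine ⟨g, ?_⟩
  ext v
  have h1 := LinearMap.congr_fun hg (f.rangeRestrict v)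
  have h2 := LinearMap.congr_fun hs (f.rangeRestrict v)
  simp only [LinearMap.comp_apply, Submodule.subtype_apply, LinearMap.id_apply] at h1 h2
  have h3 := congrArg Subtype.val h2
  simp only [LinearMap.comp_apply]
  simpa [← h1] using h3

/-- antipode as an endomorphism -/
abbrev SS (k U : Type*) [Field k] [Ring U] [HopfAlgebra k U] : Module.End k U := antipode k

lemma ker_ideal (m : ℕ) : ∀ a b : U, (SS k U ^ m) b = 0 →
    (SS k U ^ m) (a * b) = 0 ∧ (SS k U ^ m) (b * a) = 0 := by
  induction m with
  | zero => intro a b h; simp at h; simp [h]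
  | succ m ih =>
    intro a b h
    rw [pow_succ, Module.End.mul_apply] at *
    rw [Module.End.mul_apply]
    simp only [SS, antipode_mul_antidistrib] at *
    exact ⟨(ih _ _ h).2, (ih _ _ h).1⟩

lemma pow_mul_congr (m : ℕ) (a b b' : U) (h : (SS k U ^ m) b = (SS k U ^ m) b') :
    (SS k U ^ m) (a * b) = (SS k U ^ m) (a * b') := by
  rw [← sub_eq_zero, ← map_sub, ← mul_sub]
  refine (ker_ideal m _ _ ?_).1
  rw [map_sub, h, sub_self]

lemma pow_antipode_one (m : ℕ) : (SS k U ^ m) 1 = 1 := by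
  induction m with
  | zero => simp
  | succ m ih => rw [pow_succ, Module.End.mul_apply, SS, antipode_one]; exact ih

lemma pow_algebraMap (m : ℕ) (c : k) : (SS k U ^ m) (algebraMap k U c) = algebraMap k U c := by
  rw [Algebra.algebraMap_eq_smul_one, map_smul, pow_antipode_one]

lemma lT_conv (F : U →ₗ[k] U) (f g h : WithConv (U →ₗ[k] U)) :
    cv (F.lTensor U) (cv iL.toLinearMap f * (cv iR.toLinearMap g * cv iL.toLinearMap h)) =
     cv iL.toLinearMap f * (cv iR.toLinearMap (cv F g) * cv iL.toLinearMap h) := by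
  ext u
  simp only [LinearMap.convMul_def, LinearMap.comp_apply]
  show F.lTensor U (mul' k _ _) = mul' k _ _
  induction comul (R := k) u with
  | zero => simp
  | add x y hx hy => simp only [map_add, hx, hy]
  | tmul x y =>
    simp only [TensorProduct.map_tmul, mul'_apply, LinearMap.comp_apply]
    induction comul (R := k) y with
    | zero => simp
    | add x y hx hy => simp only [map_add, mul_add, hx, hy]
    | tmul y z => simp

lemma key_id (p : U →ₗ[k] U)
    (hp : comul ∘ₗ p = TensorProduct.map p p ∘ₗ comul (R := k))
    (hp1 : counit (R := k) ∘ₗ p = counit)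
    (m : ℕ) (hm : (SS k U ^ m) ∘ₗ p = SS k U ^ m) : p = LinearMap.id := by
  set G : WithConv (U →ₗ[k] U) := toConv (antipode k ∘ₗ p) with hG
  set P : WithConv (U →ₗ[k] U) := idc * G with hP
  have hPapp : ∀ u, P.ofConv u = mul' k U (TensorProduct.map LinearMap.id (antipode k ∘ₗ p)
      (comul u)) := fun u => rfl
  have hcP : ∀ u, counit (R := k) (P.ofConv u) = counit u := by
    intro u
    rw [hPapp]
    have : ∀ t : U ⊗[k] U, counit (R := k) (mul' k U
        (TensorProduct.map LinearMap.id (antipode k ∘ₗ p) t)) =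
        counit (R := k) (TensorProduct.rid k U ((counit (R := k)).lTensor U t)) := by
      intro t
      induction t with
      | zero => simp
      | add x y hx hy => simp only [map_add, hx, hy]
      | tmul x y =>
        have := LinearMap.congr_fun hp1 y
        simp only [LinearMap.comp_apply] at this
        simp [this, mul_comm]
    rw [this]
    simp
  have hcom : cv (comul (R := k) (A := U)) P =
      cv iL.toLinearMap idc * (cv iR.toLinearMap P * cv iL.toLinearMap G) := by
    rw [hP, comul_alg_cv, cv_mul, ← comul_alg_cv, ← comul_alg_cv, comul_eq_conv,
      antipode_comul_comp p hp, cv_mul]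
    simp only [mul_assoc, hG]
  have hE0 : cv (SS k U ^ m) P = 1 := by
    have : ∀ t : U ⊗[k] U, (SS k U ^ m) (mul' k U
        (TensorProduct.map LinearMap.id (antipode k ∘ₗ p) t)) =
        (SS k U ^ m) (mul' k U ((antipode k).lTensor U t)) := by
      intro t
      induction t with
      | zero => simp
      | add x y hx hy => simp only [map_add, hx, hy]
      | tmul x y =>
        simp only [TensorProduct.map_tmul, mul'_apply, LinearMap.lTensor_tmul, LinearMap.id_apply,
          LinearMap.comp_apply]
        apply pow_mul_congr
        show ((SS k U ^ m) * SS k U) (p y) = ((SS k U ^ m) * SS k U) y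
        rw [← pow_succ, pow_succ', Module.End.mul_apply, Module.End.mul_apply]
        congr 1
        exact LinearMap.congr_fun hm y
    ext u
    show (SS k U ^ m) (P.ofConv u) = _
    rw [hPapp, this, mul_antipode_lTensor_comul_apply, pow_algebraMap]
    rfl
  have step : ∀ j : ℕ, cv (SS k U ^ (j+1)) P = 1 → cv (SS k U ^ j) P = 1 := by
    intro j hj
    have h1 : cv ((SS k U ^ (j+1)).lTensor U) (cv (comul (R := k) (A := U)) P) =
        cv iL.toLinearMap P := by
      rw [hcom, lT_conv, hj, cv_one, one_mul, ← cv_mul]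
    obtain ⟨κ, hκ⟩ := exists_gen_inv (SS k U ^ j)
    have h2 : ∀ t : U ⊗[k] U, (SS k U ^ j) (mul' k U ((antipode k).lTensor U t)) =
       (SS k U ^ j) (mul' k U (κ.lTensor U ((SS k U ^ (j+1)).lTensor U t))) := by
      intro t
      induction t with
      | zero => simp
      | add x y hx hy => simp only [map_add, hx, hy]
      | tmul x y =>
        simp only [mul'_apply, LinearMap.lTensor_tmul]
        apply pow_mul_congr
        have := LinearMap.congr_fun hκ (SS k U y)
        simp only [LinearMap.comp_apply] at this
        rw [pow_succ, Module.End.mul_apply, this]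
    ext u
    have h3 := congrArg (fun f => f.ofConv u) h1
    simp only [LinearMap.comp_apply] at h3
    have h4 := h2 (comul (P.ofConv u))
    rw [h3, mul_antipode_lTensor_comul_apply, hcP, pow_algebraMap] at h4
    have h5 := h2 (P.ofConv u ⊗ₜ 1)
    simp only [LinearMap.lTensor_tmul, pow_antipode_one, antipode_one, mul'_apply, mul_one] at h5
    show (SS k U ^ j) (P.ofConv u) = algebraMap k U (counit u)
    rw [h4, h5]
    simp
  have hE : ∀ j, cv (SS k U ^ j) P = 1 → P = 1 := by
    intro j
    induction j with
    | zero => intro h; exact h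
    | succ j ih => intro h; exact ih (step j h)
  have hP1 : P = 1 := hE m hE0
  have hGp : toConv p * G = 1 := by
    ext u
    have h2 := LinearMap.congr_fun hp u
    have h3 := LinearMap.congr_fun hp1 u
    simp only [LinearMap.comp_apply] at h2 h3
    have h := mul_antipode_lTensor_comul_apply (R := k) (p u)
    rw [h2, h3, ← LinearMap.comp_apply (LinearMap.lTensor _ _), LinearMap.lTensor_comp_map] at h
    exact h
  have hG1 : G = Sc := by
    have := left_inv_eq_right_inv (a := (idc : WithConv (U →ₗ[k] U))) (b := Sc) (c := G)
      antipode_mul_id hP1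
    exact this.symm
  have : toConv p = idc := by
    rw [hG1] at hGp
    exact left_inv_eq_right_inv hGp antipode_mul_id
  exact congrArg (fun f => f.ofConv) this

lemma co_sq : comul ∘ₗ (SS k U ^ 2) =
    TensorProduct.map (SS k U ^ 2) (SS k U ^ 2) ∘ₗ comul (R := k) := by
  ext u
  simp only [LinearMap.comp_apply, pow_two, Module.End.mul_apply]
  rw [SS, antipode_comul_apply, antipode_comul_apply]
  induction comul (R := k) u with
  | zero => simp
  | tmul x y => simp
  | add x y hx hy => simp only [map_add, hx, hy]

lemma co_pow (n : ℕ) : comul ∘ₗ ((SS k U ^ 2) ^ n) =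
    TensorProduct.map ((SS k U ^ 2) ^ n) ((SS k U ^ 2) ^ n) ∘ₗ comul (R := k) := by
  induction n with
  | zero => simp [Module.End.one_eq_id]
  | succ n ih =>
    rw [pow_succ, Module.End.mul_eq_comp, ← LinearMap.comp_assoc, ih, LinearMap.comp_assoc,
      co_sq, TensorProduct.map_comp, LinearMap.comp_assoc]

lemma counit_pow (n : ℕ) : counit (R := k) ∘ₗ (SS k U ^ n) = counit := by
  induction n with
  | zero => simp [Module.End.one_eq_id]
  | succ n ih =>
    rw [pow_succ, Module.End.mul_eq_comp, ← LinearMap.comp_assoc, ih, counit_comp_antipode]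

lemma antipode_bijective [FiniteDimensional k U] :
    Function.Bijective (antipode k : U →ₗ[k] U) := by
  set n := Module.finrank k U
  set F : Module.End k U := SS k U ^ (2 * n) with hF
  have hFco : comul ∘ₗ F = TensorProduct.map F F ∘ₗ comul (R := k) := by
    rw [hF, pow_mul]; exact co_pow n
  have hFc : counit (R := k) ∘ₗ F = counit := counit_pow _
  have hker : LinearMap.ker (F ∘ₗ F) = LinearMap.ker F := by
    rw [← Module.End.mul_eq_comp, hF, ← pow_add]
    exact (Module.End.ker_pow_eq_ker_pow_finrank_of_le (by omega)).trans
      (Module.End.ker_pow_eq_ker_pow_finrank_of_le (by omega)).symm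
  have hrange : LinearMap.range (F ∘ₗ F) = LinearMap.range F := by
    apply Submodule.eq_of_le_of_finrank_eq (LinearMap.range_comp_le_range _ _)
    have h1 := LinearMap.finrank_range_add_finrank_ker F
    have h2 := LinearMap.finrank_range_add_finrank_ker (F ∘ₗ F)
    rw [hker] at h2
    omega
  obtain ⟨g, hg⟩ := exists_gen_inv (F ∘ₗ F)
  -- `F F (g F) = F`
  have hR : F ∘ₗ F ∘ₗ g ∘ₗ F = F := by
    ext x
    have : F x ∈ LinearMap.range (F ∘ₗ F) := by rw [hrange]; exact ⟨x, rfl⟩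
    obtain ⟨y, hy⟩ := this
    have := LinearMap.congr_fun hg y
    simp only [LinearMap.comp_apply] at this hy ⊢
    rw [← hy, this]
  have hL : F ∘ₗ g ∘ₗ F ∘ₗ F = F := by
    ext x
    have h := LinearMap.congr_fun hg x
    have : g (F (F x)) - x ∈ LinearMap.ker F := by
      rw [← hker]
      simp only [LinearMap.comp_apply] at h
      simp [h]
    simp only [LinearMap.mem_ker, map_sub, sub_eq_zero] at this
    exact this
  set p := F ∘ₗ g ∘ₗ F with hp
  have hFp : F ∘ₗ p = F := hR
  have hpco : comul ∘ₗ p = TensorProduct.map p p ∘ₗ comul (R := k) := by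
    ext x
    simp only [LinearMap.comp_apply]
    have inj : ∀ t : U ⊗[k] U, TensorProduct.map F F (TensorProduct.map F F t) = 0 →
        TensorProduct.map F F t = 0 := by
      intro t ht
      have h := congrArg (TensorProduct.map (F ∘ₗ g) (F ∘ₗ g)) ht
      rw [map_zero, ← LinearMap.comp_apply, ← TensorProduct.map_comp,
        ← LinearMap.comp_apply, ← TensorProduct.map_comp] at h
      simp only [LinearMap.comp_assoc] at h
      rwa [hL] at h
    have hFco' := fun y => LinearMap.congr_fun hFco y
    simp only [LinearMap.comp_apply] at hFco'
    have e1 : comul (R := k) (p x) = TensorProduct.map F F (comul (g (F x))) := hFco' _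
    have e2 : TensorProduct.map p p (comul (R := k) x) =
        TensorProduct.map F F (TensorProduct.map (g ∘ₗ F) (g ∘ₗ F) (comul x)) := by
      rw [← LinearMap.comp_apply (TensorProduct.map F F), ← TensorProduct.map_comp]
    rw [e1, e2, ← sub_eq_zero, ← map_sub]
    apply inj
    rw [map_sub, ← e1, ← e2, map_sub, ← hFco', ← LinearMap.comp_apply (TensorProduct.map F F),
      ← TensorProduct.map_comp, hFp, ← hFco', ← LinearMap.comp_apply F, hFp, sub_self]
  have hpc : counit (R := k) ∘ₗ p = counit := by
    have : counit (R := k) ∘ₗ F ∘ₗ p = counit := by rw [hFp, hFc]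
    rwa [← LinearMap.comp_assoc, hFc] at this
  have hpid := key_id p hpco hpc (2 * n) hFp
  have hinj : Function.Injective (antipode k : U →ₗ[k] U) := by
    intro x y hxy
    have e : F x = F y := by
      rcases Nat.eq_zero_or_pos n with h0 | h0
      · have := Module.finrank_zero_iff.mp h0
        exact congrArg F (Subsingleton.elim x y)
      · obtain ⟨m, hm⟩ : ∃ m, 2 * n = m + 1 := ⟨2 * n - 1, by omega⟩
        rw [hF, hm, pow_succ, Module.End.mul_apply, Module.End.mul_apply]
        exact congrArg _ hxy
    have := congrArg (fun z => F (g z)) e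
    have hx := LinearMap.congr_fun hpid x
    have hy := LinearMap.congr_fun hpid y
    simp only [hp, LinearMap.comp_apply, LinearMap.id_apply] at hx hy
    rw [← hx, ← hy]
    exact this
  exact ⟨hinj, LinearMap.injective_iff_surjective.mp hinj⟩

end antipode

section main
open LinearMap WithConv HopfAlgebra Coalgebra
universe u w v
variable {k : Type w} {U : Type u} [Field k] [Ring U] [HopfAlgebra k U]

/-- Linear maps `U → Y` which are `A`-linear for the (pseudo-)action `ρ`. -/
def GS (A : Subalgebra k U) {Y : Type v} [AddCommGroup Y] [Module k Y]
    (ρ : U →ₗ[k] Y →ₗ[k] Y) : Submodule k (U →ₗ[k] Y) where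
  carrier := {g | ∀ a ∈ A, ∀ u, g (a * u) = ρ a (g u)}
  zero_mem' := by intro a _ u; simp
  add_mem' := by intro f g hf hg a ha u; simp [hf a ha u, hg a ha u]
  smul_mem' := by intro c f hf a ha u; simp [hf a ha u]

/-- The bilinear ingredient of `Eact`. -/
def Ebil {Y : Type v} [AddCommGroup Y] [Module k Y] (ρ : U →ₗ[k] Y →ₗ[k] Y) :
    U →ₗ[k] U →ₗ[k] ((U →ₗ[k] Y) →ₗ[k] (U →ₗ[k] Y)) :=
  LinearMap.mk₂ k (fun x y =>
    { toFun := fun f => ρ x ∘ₗ f ∘ₗ LinearMap.mulRight k y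
      map_add' := by intro f g; ext u; simp
      map_smul' := by intro c f; ext u; simp })
    (by intro x x' y; ext f u; simp)
    (by intro c x y; ext f u; simp)
    (by intro x y y'; ext f u; simp [mul_add])
    (by intro c x y; ext f u; simp)

/-- The action `(a f)(u) = a₁ f(u a₂)` on `Hom(U, Y)`. -/
def Eact {Y : Type v} [AddCommGroup Y] [Module k Y] (ρ : U →ₗ[k] Y →ₗ[k] Y) :
    U →ₗ[k] ((U →ₗ[k] Y) →ₗ[k] (U →ₗ[k] Y)) :=
  TensorProduct.lift (Ebil ρ) ∘ₗ comul

lemma Ebil_apply {Y : Type v} [AddCommGroup Y] [Module k Y] (ρ : U →ₗ[k] Y →ₗ[k] Y)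
    (x y : U) (f : U →ₗ[k] Y) (u : U) : Ebil ρ x y f u = ρ x (f (u * y)) := rfl

/-- Induction over `A ⊗ U`. -/
lemma coideal_induction {A : Subalgebra k U} (hA : IsRightCoidealSubalgebra k A)
    {M : Type*} [AddCommGroup M] [Module k M] (f g : U ⊗[k] U →ₗ[k] M)
    (h : ∀ a ∈ A, ∀ b : U, f (a ⊗ₜ b) = g (a ⊗ₜ b)) {a : U} (ha : a ∈ A) :
    f (comul (R := k) a) = g (comul (R := k) a) := by
  obtain ⟨z, hz⟩ := hA a ha
  rw [← hz]
  clear hz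
  induction z with
  | zero => simp
  | add x y hx hy => simp only [map_add, hx, hy]
  | tmul x y => exact h _ x.2 _

/-- The linear map `U ⊗ U → Y` attached to `θ`. -/
def Th {Y : Type v} [AddCommGroup Y] [Module k Y] {A : Subalgebra k U}
    {ρ : U →ₗ[k] Y →ₗ[k] Y} (θ : U →ₗ[k] GS A ρ) : U ⊗[k] U →ₗ[k] Y :=
  TensorProduct.lift ((GS A ρ).subtype ∘ₗ θ)

lemma Th_tmul {Y : Type v} [AddCommGroup Y] [Module k Y] {A : Subalgebra k U}
    {ρ : U →ₗ[k] Y →ₗ[k] Y} (θ : U →ₗ[k] GS A ρ) (x y : U) :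
    Th θ (x ⊗ₜ y) = (θ x : U →ₗ[k] Y) y := rfl

/-- `Ψ θ v u = θ (u v₂) v₁`. -/
def PsiFun {Y : Type v} [AddCommGroup Y] [Module k Y] {A : Subalgebra k U}
    {ρ : U →ₗ[k] Y →ₗ[k] Y} (θ : U →ₗ[k] GS A ρ) : U →ₗ[k] (U →ₗ[k] Y) :=
  LinearMap.mk₂ k (fun v u => Th θ ((u ⊗ₜ[k] (1:U)) * TensorProduct.comm k U U (comul v)))
    (by intro x x' y; simp [mul_add])
    (by intro c x y; simp)
    (by intro x y y'; simp [TensorProduct.add_tmul, add_mul])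
    (by intro c x y; rw [← TensorProduct.smul_tmul', smul_mul_assoc, map_smul])

lemma PsiFun_apply {Y : Type v} [AddCommGroup Y] [Module k Y] {A : Subalgebra k U}
    {ρ : U →ₗ[k] Y →ₗ[k] Y} (θ : U →ₗ[k] GS A ρ) (v u : U) :
    PsiFun θ v u = Th θ ((u ⊗ₜ[k] (1:U)) * TensorProduct.comm k U U (comul v)) := rfl

lemma PsiFun_mem {Y : Type v} [AddCommGroup Y] [Module k Y] {A : Subalgebra k U}
    (hA : IsRightCoidealSubalgebra k A)
    {ρ : U →ₗ[k] Y →ₗ[k] Y} (θ : U →ₗ[k] GS A ρ) : PsiFun θ ∈ GS A (Eact ρ) := by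
  intro a ha v
  ext u
  rw [PsiFun_apply, Bialgebra.comul_mul]
  let f : U ⊗[k] U →ₗ[k] Y := Th θ ∘ₗ LinearMap.mulLeft k (u ⊗ₜ[k] (1:U)) ∘ₗ
    (TensorProduct.comm k U U).toLinearMap ∘ₗ LinearMap.mulRight k (comul (R := k) v)
  let g : U ⊗[k] U →ₗ[k] Y := LinearMap.applyₗ u ∘ₗ LinearMap.applyₗ (PsiFun θ v) ∘ₗ
    TensorProduct.lift (Ebil ρ)
  refine coideal_induction hA f g ?_ ha
  intro x hx y
  show Th θ ((u ⊗ₜ[k] (1:U)) * TensorProduct.comm k U U ((x ⊗ₜ y) * comul v)) =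
    ρ x (PsiFun θ v (u * y))
  rw [PsiFun_apply]
  induction comul (R := k) v with
  | zero => simp
  | add x y hx hy => simp only [map_add, mul_add, hx, hy]
  | tmul p q =>
    simp only [Algebra.TensorProduct.tmul_mul_tmul, TensorProduct.comm_tmul, Th_tmul, one_mul]
    rw [(θ _).2 x hx, mul_assoc]

/-- the twisted antipode -/
lemma exists_twisted [FiniteDimensional k U] : ∃ T : U →ₗ[k] U, ∀ v : U,
    mul' k U (TensorProduct.map T LinearMap.id (TensorProduct.comm k U U (comul v))) =
      algebraMap k U (counit v) := by
  let e := LinearEquiv.ofBijective (antipode k : U →ₗ[k] U) antipode_bijective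
  refine ⟨e.symm.toLinearMap, fun v => ?_⟩
  have he : ∀ x, antipode k (e.symm x) = x := fun x => e.apply_symm_apply x
  apply (antipode_bijective (k := k) (U := U)).1
  have h1 : antipode k (algebraMap k U (counit (R := k) v)) = algebraMap k U (counit v) := by
    rw [Algebra.algebraMap_eq_smul_one, map_smul, antipode_one]
  rw [h1, ← mul_antipode_rTensor_comul_apply]
  induction comul (R := k) v with
  | zero => simp
  | add x y hx hy => simp only [map_add, hx, hy]
  | tmul x y => simp [antipode_mul_antidistrib, he]

lemma PsiFun_inj [FiniteDimensional k U]
    {Y : Type v} [AddCommGroup Y] [Module k Y] {A : Subalgebra k U}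
    {ρ : U →ₗ[k] Y →ₗ[k] Y} (θ : U →ₗ[k] GS A ρ) (h : PsiFun θ = 0) : θ = 0 := by
  obtain ⟨T, hT⟩ := exists_twisted (k := k) (U := U)
  ext u v
  show (θ u : U →ₗ[k] Y) v = 0
  -- the map `x ⊗ w ↦ θ (u T(w₂) w₁) x`
  let κ : U ⊗[k] U →ₗ[k] U :=
    mul' k U ∘ₗ TensorProduct.map T LinearMap.id ∘ₗ (TensorProduct.comm k U U).toLinearMap
  let Q : U ⊗[k] (U ⊗[k] U) →ₗ[k] Y :=
    Th θ ∘ₗ (TensorProduct.comm k U U).toLinearMap ∘ₗ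
      (LinearMap.mulLeft k u ∘ₗ κ).lTensor U
  have h1 : ∀ t : U ⊗[k] U, Q (TensorProduct.assoc k U U U (comul.rTensor U t)) = 0 := by
    intro t
    induction t with
    | zero => simp
    | add x y hx hy => simp only [map_add, hx, hy, add_zero]
    | tmul x y =>
      have h2 : PsiFun θ x (u * T y) = 0 := by rw [h]; rfl
      rw [PsiFun_apply] at h2
      rw [LinearMap.rTensor_tmul, ← h2]
      induction comul (R := k) x with
      | zero => simp
      | add x y hx hy => simp only [map_add, TensorProduct.add_tmul, mul_add, hx, hy]
      | tmul p q => simp [Q, κ, Th_tmul, mul_assoc]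
  have h3 := h1 (comul v)
  rw [Coalgebra.coassoc_apply] at h3
  have h4 : ∀ t : U ⊗[k] U, Q (comul.lTensor U t) =
      (θ u : U →ₗ[k] Y) (TensorProduct.rid k U (counit.lTensor U t)) := by
    intro t
    induction t with
    | zero => simp
    | add x y hx hy => simp only [map_add, hx, hy]
    | tmul x y =>
      have : κ (comul y) = algebraMap k U (counit y) := hT y
      simp only [LinearMap.lTensor_tmul, Q, LinearMap.comp_apply, this,
        LinearEquiv.coe_coe, TensorProduct.comm_tmul, Th_tmul, LinearMap.mulLeft_apply]
      simp [Algebra.algebraMap_eq_smul_one]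
  rw [h4] at h3
  simpa using h3

lemma GS_lower [FiniteDimensional k U] {A : Subalgebra k U} (hA : IsRightCoidealSubalgebra k A)
    {Y : Type v} [AddCommGroup Y] [Module k Y] [FiniteDimensional k Y]
    (ρ : U →ₗ[k] Y →ₗ[k] Y) :
    Module.finrank k U * Module.finrank k (GS A ρ) ≤ Module.finrank k (GS A (Eact ρ)) := by
  let Ψ : (U →ₗ[k] GS A ρ) →ₗ[k] GS A (Eact ρ) :=
    { toFun := fun θ => ⟨PsiFun θ, PsiFun_mem hA θ⟩
      map_add' := by
        intro θ θ'
        ext v u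
        have : Th (θ + θ') = Th θ + Th θ' := by ext; simp [Th]
        simp [PsiFun_apply, this]
      map_smul' := by
        intro c θ
        ext v u
        have : Th (c • θ) = c • Th θ := by ext; simp [Th]
        simp [PsiFun_apply, this] }
  rw [← Module.finrank_linearMap k k U (GS A ρ)]
  apply LinearMap.finrank_le_finrank_of_injective (f := Ψ)
  intro θ θ' hθ
  have h0 : PsiFun θ = PsiFun θ' := congrArg Subtype.val hθ
  rw [← sub_eq_zero]
  apply PsiFun_inj
  have hT : Th (θ - θ') = Th θ - Th θ' := by ext; simp [Th]
  ext v u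
  have h1 := LinearMap.congr_fun (LinearMap.congr_fun h0 v) u
  rw [PsiFun_apply, PsiFun_apply] at h1
  rw [PsiFun_apply, hT, LinearMap.sub_apply, h1, sub_self]
  rfl

/-- the trivial action -/
def triv (k : Type w) (U : Type u) [Field k] [Ring U] [HopfAlgebra k U]
    (Y : Type v) [AddCommGroup Y] [Module k Y] : U →ₗ[k] Y →ₗ[k] Y :=
  (LinearMap.lsmul k Y) ∘ₗ counit

lemma triv_apply {Y : Type v} [AddCommGroup Y] [Module k Y] (a : U) (y : Y) :
    triv k U Y a y = counit (R := k) a • y := rfl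

/-- `c = dim Hom_A(U, k)`. -/
def cc (A : Subalgebra k U) : ℕ := Module.finrank k (GS A (triv k U k))

lemma GS_triv [FiniteDimensional k U] (A : Subalgebra k U)
    (Y : Type v) [AddCommGroup Y] [Module k Y] [FiniteDimensional k Y] :
    Module.finrank k (GS A (triv k U Y)) ≤ cc A * Module.finrank k Y := by
  let b := Module.finBasis k Y
  let f : GS A (triv k U Y) →ₗ[k] (Fin (Module.finrank k Y) → GS A (triv k U k)) :=
    LinearMap.pi (fun i =>
      { toFun := fun g => ⟨b.coord i ∘ₗ g.1, by
          intro a ha u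
          have := g.2 a ha u
          simp only [LinearMap.comp_apply, this, triv_apply, map_smul]⟩
        map_add' := by intro g h; ext u; simp
        map_smul' := by intro c g; ext u; simp })
  have hf : Function.Injective f := by
    intro g h hgh
    ext u
    apply b.repr.injective
    ext i
    have := congrFun hgh i
    have := LinearMap.congr_fun (congrArg Subtype.val this) u
    exact this
  have := LinearMap.finrank_le_finrank_of_injective hf
  rwa [Module.finrank_pi_fintype, Finset.sum_const, Finset.card_univ, Fintype.card_fin,
    smul_eq_mul, mul_comm] at this

/-- Subadditivity with a trivial submodule. -/
lemma GS_quot [FiniteDimensional k U] (A : Subalgebra k U)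
    {Y : Type v} [AddCommGroup Y] [Module k Y] [FiniteDimensional k Y]
    (ρ : U →ₗ[k] Y →ₗ[k] Y) (D : Submodule k Y)
    (hD : ∀ a ∈ A, ∀ y ∈ D, ρ a y = counit (R := k) a • y) :
    ∃ ρ' : U →ₗ[k] (Y ⧸ D) →ₗ[k] (Y ⧸ D), Module.finrank k (GS A ρ) ≤
      Module.finrank k (GS A ρ') + cc A * Module.finrank k D := by
  obtain ⟨s, hs⟩ := D.mkQ.exists_rightInverse_of_surjective D.range_mkQ
  have hs' : ∀ y, D.mkQ (s y) = y := fun y => LinearMap.congr_fun hs y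
  let ρ' : U →ₗ[k] (Y ⧸ D) →ₗ[k] (Y ⧸ D) :=
    { toFun := fun a => D.mkQ ∘ₗ ρ a ∘ₗ s
      map_add' := by intro a b; ext; simp
      map_smul' := by intro a b; ext; simp }
  have hρ' : ∀ a ∈ A, ∀ y, ρ' a (D.mkQ y) = D.mkQ (ρ a y) := by
    intro a ha y
    show D.mkQ (ρ a (s (D.mkQ y))) = D.mkQ (ρ a y)
    have h1 : s (D.mkQ y) - y ∈ D := by
      apply (Submodule.Quotient.mk_eq_zero D).mp
      change D.mkQ (s (D.mkQ y) - y) = 0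
      rw [map_sub, hs', sub_self]
    have h2 : ρ a (s (D.mkQ y) - y) ∈ D := by
      rw [hD a ha _ h1]; exact D.smul_mem _ h1
    rw [← sub_eq_zero, ← map_sub, ← map_sub]
    exact (Submodule.Quotient.mk_eq_zero D).mpr h2
  refine ⟨ρ', ?_⟩
  let F : GS A ρ →ₗ[k] GS A ρ' :=
    { toFun := fun g => ⟨D.mkQ ∘ₗ g.1, by
        intro a ha u
        simp only [LinearMap.comp_apply]
        rw [hρ' a ha, g.2 a ha u]⟩
      map_add' := by intro g h; ext u; simp
      map_smul' := by intro c g; ext u; simp }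
  have hFk : ∀ g : LinearMap.ker F, ∀ u, (g.1 : U →ₗ[k] Y) u ∈ D := by
    intro g u
    have h := LinearMap.congr_fun (congrArg Subtype.val (LinearMap.mem_ker.mp g.2)) u
    exact (Submodule.Quotient.mk_eq_zero D).mp h
  let K : LinearMap.ker F →ₗ[k] GS A (triv k U D) :=
    { toFun := fun g => ⟨LinearMap.codRestrict D (g.1 : U →ₗ[k] Y) (hFk g), by
        intro a ha u
        apply Subtype.ext
        have := g.1.2 a ha u
        show (g.1 : U →ₗ[k] Y) (a * u) = counit (R := k) a • (g.1 : U →ₗ[k] Y) u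
        rw [this, hD a ha _ (hFk g u)]⟩
      map_add' := by intro g h; ext u; simp
      map_smul' := by intro c g; ext u; simp }
  have hK : Function.Injective K := by
    intro g h hgh
    ext u
    have := LinearMap.congr_fun (congrArg Subtype.val hgh) u
    exact congrArg Subtype.val this
  have h1 := LinearMap.finrank_range_add_finrank_ker (K := k) (V := ↥(GS A ρ)) (V₂ := ↥(GS A ρ')) F
  have h2 := LinearMap.finrank_le_finrank_of_injective hK
  have h3 := GS_triv A D
  have h4 := Submodule.finrank_le (LinearMap.range F)
  omega

/-- One step of the improvement. -/
lemma GS_step [FiniteDimensional k U] {A : Subalgebra k U} (hA : IsRightCoidealSubalgebra k A)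
    {Y : Type v} [AddCommGroup Y] [Module k Y] [FiniteDimensional k Y]
    (ρ : U →ₗ[k] Y →ₗ[k] Y) :
    ∃ D : Submodule k (U →ₗ[k] Y), Module.finrank k D = Module.finrank k (GS A ρ) ∧
    ∃ ρ' : U →ₗ[k] ((U →ₗ[k] Y) ⧸ D) →ₗ[k] ((U →ₗ[k] Y) ⧸ D),
      Module.finrank k U * Module.finrank k (GS A ρ) ≤
      Module.finrank k (GS A ρ') + cc A * Module.finrank k (GS A ρ) := by
  let j : GS A ρ →ₗ[k] (U →ₗ[k] Y) :=
    { toFun := fun g => g.1 ∘ₗ antipode k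
      map_add' := by intro g h; ext u; simp
      map_smul' := by intro c g; ext u; simp }
  have hj : Function.Injective j := by
    intro g h hgh
    ext u
    obtain ⟨v, rfl⟩ := (antipode_bijective (k := k) (U := U)).2 u
    exact LinearMap.congr_fun hgh v
  have hD : ∀ a ∈ A, ∀ y ∈ LinearMap.range j, Eact ρ a y = counit (R := k) a • y := by
    rintro a ha _ ⟨g, rfl⟩
    ext u
    let f : U ⊗[k] U →ₗ[k] Y := LinearMap.applyₗ u ∘ₗ LinearMap.applyₗ (j g) ∘ₗ
      TensorProduct.lift (Ebil ρ)
    let f' : U ⊗[k] U →ₗ[k] Y := g.1 ∘ₗ LinearMap.mulRight k (antipode k u) ∘ₗ mul' k U ∘ₗ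
      (antipode k).lTensor U
    have h1 : f (comul a) = f' (comul a) := by
      refine coideal_induction hA f f' ?_ ha
      intro x hx y
      show ρ x (g.1 (antipode k (u * y))) = g.1 (x * antipode k y * antipode k u)
      rw [antipode_mul_antidistrib, mul_assoc, g.2 x hx]
    refine h1.trans ?_
    simp only [f', LinearMap.comp_apply, mul_antipode_lTensor_comul_apply,
      LinearMap.mulRight_apply, Algebra.algebraMap_eq_smul_one, one_mul, map_smul]
    rfl
  have hr : Module.finrank k (LinearMap.range j) = Module.finrank k (GS A ρ) :=
    LinearMap.finrank_range_of_inj hj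
  refine ⟨LinearMap.range j, hr, ?_⟩
  obtain ⟨ρ', h⟩ := GS_quot A (Eact ρ) _ hD
  refine ⟨ρ', (GS_lower hA ρ).trans ?_⟩
  rwa [hr] at h

/-- The bound `dim Hom_A(U, Y) ≤ c dim Y`. -/
lemma GS_bound [FiniteDimensional k U] {A : Subalgebra k U}
    (hA : IsRightCoidealSubalgebra k A)
    {Y : Type (max u w)} [AddCommGroup Y] [Module k Y] [FiniteDimensional k Y]
    (ρ : U →ₗ[k] Y →ₗ[k] Y) :
    Module.finrank k (GS A ρ) ≤ cc A * Module.finrank k Y := by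
  let Bd : ℝ → Prop := fun r => ∀ (Y : Type (max u w)) [AddCommGroup Y] [Module k Y]
    [FiniteDimensional k Y] (ρ : U →ₗ[k] Y →ₗ[k] Y),
    (Module.finrank k (GS A ρ) : ℝ) ≤ r * Module.finrank k Y
  let R : Set ℝ := {r | 0 ≤ r ∧ Bd r}
  have hgen : ∀ {Y : Type (max u w)} [AddCommGroup Y] [Module k Y] [FiniteDimensional k Y]
      (ρ : U →ₗ[k] Y →ₗ[k] Y),
      Module.finrank k (GS A ρ) ≤ Module.finrank k U * Module.finrank k Y := by
    intro Y _ _ _ ρ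
    rw [← Module.finrank_linearMap k k]
    exact Submodule.finrank_le _
  have hRne : R.Nonempty := by
    refine ⟨Module.finrank k U, by positivity, ?_⟩
    intro Y _ _ _ ρ
    exact_mod_cast hgen ρ
  have hbdd : BddBelow R := ⟨0, fun r hr => hr.1⟩
  set r := sInf R with hr
  have hr0 : 0 ≤ r := le_csInf hRne fun r hr => hr.1
  have hrB : Bd r := by
    intro Y _ _ _ ρ
    rcases Nat.eq_zero_or_pos (Module.finrank k Y) with h0 | h0
    · have := hgen ρ
      rw [h0, mul_zero] at this
      have h : Module.finrank k (GS A ρ) = 0 := by omega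
      simp [h0, h]
    · have hpos : (0:ℝ) < Module.finrank k Y := by exact_mod_cast h0
      rw [← div_le_iff₀ hpos]
      apply le_csInf hRne
      intro s hs
      rw [div_le_iff₀ hpos]
      exact hs.2 Y ρ
  set n : ℝ := ((Module.finrank k U : ℕ) : ℝ) with hn
  set c : ℝ := ((cc A : ℕ) : ℝ) with hc
  have hcn : c ≤ n := by
    have : cc A ≤ Module.finrank k U := by
      have := Submodule.finrank_le (GS A (triv k U k))
      rwa [Module.finrank_linearMap, Module.finrank_self, mul_one] at this
    rw [hn, hc]
    exact_mod_cast this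
  have hrc : r ≤ c := by
    by_contra hlt
    push Not at hlt
    have hc0 : 0 ≤ c := by positivity
    have hd : 0 < n - c + r := by linarith
    have hmem : r * n / (n - c + r) ∈ R := by
      refine ⟨by positivity, ?_⟩
      intro Y _ _ _ ρ
      obtain ⟨D, hD, ρ', h⟩ := GS_step hA ρ
      have h1 := hrB _ ρ'
      have h2 := D.finrank_quotient_add_finrank
      rw [Module.finrank_linearMap, hD] at h2
      have h3 : (Module.finrank k ((U →ₗ[k] Y) ⧸ D) : ℝ) + Module.finrank k (GS A ρ) =
        n * Module.finrank k Y := by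
        rw [hn]
        exact_mod_cast h2
      have h4 : n * Module.finrank k (GS A ρ) ≤ (Module.finrank k (GS A ρ') : ℝ) +
        c * Module.finrank k (GS A ρ) := by
        rw [hn, hc]
        exact_mod_cast h
      rw [div_mul_eq_mul_div, le_div_iff₀ hd]
      have h5 : (Module.finrank k ((U →ₗ[k] Y) ⧸ D) : ℝ) =
        n * Module.finrank k Y - Module.finrank k (GS A ρ) := by linarith
      rw [h5] at h1
      linarith
    have hle : r ≤ r * n / (n - c + r) := csInf_le hbdd hmem
    rw [le_div_iff₀ hd] at hle
    have hrpos : 0 < r := by linarith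
    nlinarith
  have h1 := hrB Y ρ
  have : (Module.finrank k (GS A ρ) : ℝ) ≤ c * Module.finrank k Y :=
    h1.trans (mul_le_mul_of_nonneg_right hrc (by positivity))
  rw [hc] at this
  exact_mod_cast this

/-- Lifting along an equivariant functional. -/
lemma GS_sub [FiniteDimensional k U] (A : Subalgebra k U)
    {Y : Type v} [AddCommGroup Y] [Module k Y] [FiniteDimensional k Y]
    (ρ : U →ₗ[k] Y →ₗ[k] Y) (ev : Y →ₗ[k] k)
    (hev : ∀ a ∈ A, ∀ y, ev (ρ a y) = counit (R := k) a • ev y)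
    (D : Submodule k Y) (hD : ∀ y, ev y = 0 → y ∈ D) :
    ∃ ρ₁ : U →ₗ[k] D →ₗ[k] D,
      cc A + Module.finrank k (GS A ρ₁) ≤ Module.finrank k (GS A ρ) →
      ∀ g ∈ GS A (triv k U k), ∃ b ∈ GS A ρ, ∀ u, ev (b u) = g u := by
  obtain ⟨q, hq⟩ : ∃ q : Y →ₗ[k] D, q ∘ₗ D.subtype = LinearMap.id :=
    LinearMap.exists_leftInverse_of_injective (Submodule.subtype D) (Submodule.ker_subtype D)
  have hq' : ∀ y : D, q y = y := fun y => LinearMap.congr_fun hq y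
  let ρ₁ : U →ₗ[k] D →ₗ[k] D :=
    { toFun := fun a => q ∘ₗ ρ a ∘ₗ D.subtype
      map_add' := by intro a b; ext; simp
      map_smul' := by intro a b; ext; simp }
  refine ⟨ρ₁, fun hle g hg => ?_⟩
  let F : GS A ρ →ₗ[k] GS A (triv k U k) :=
    { toFun := fun b => ⟨ev ∘ₗ b.1, by
        intro a ha u
        simp only [LinearMap.comp_apply]
        rw [b.2 a ha u, hev a ha]; rfl⟩
      map_add' := by intro g h; ext u; simp
      map_smul' := by intro c g; ext u; simp }
  have hFk : ∀ b : LinearMap.ker F, ∀ u, (b.1 : U →ₗ[k] Y) u ∈ D := by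
    intro b u
    exact hD _ (LinearMap.congr_fun (congrArg Subtype.val (LinearMap.mem_ker.mp b.2)) u)
  have hFq : ∀ b : LinearMap.ker F, ∀ u,
      q ((b.1 : U →ₗ[k] Y) u) = ⟨(b.1 : U →ₗ[k] Y) u, hFk b u⟩ :=
    fun b u => hq' ⟨(b.1 : U →ₗ[k] Y) u, hFk b u⟩
  let K : LinearMap.ker F →ₗ[k] GS A ρ₁ :=
    { toFun := fun b => ⟨q ∘ₗ (b.1 : U →ₗ[k] Y), by
        intro a ha u
        show q ((b.1 : U →ₗ[k] Y) (a * u)) = q (ρ a (q ((b.1 : U →ₗ[k] Y) u) : Y))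
        rw [b.1.2 a ha u, hFq b u]⟩
      map_add' := by intro g h; ext u; simp
      map_smul' := by intro c g; ext u; simp }
  have hK : Function.Injective K := by
    intro b b' hbb
    ext u
    have h3 : q ((b.1 : U →ₗ[k] Y) u) = q ((b'.1 : U →ₗ[k] Y) u) :=
      LinearMap.congr_fun (congrArg Subtype.val hbb) u
    rw [hFq, hFq] at h3
    exact congrArg Subtype.val h3
  have e2 := LinearMap.finrank_range_add_finrank_ker (K := k) (V := ↥(GS A ρ))
    (V₂ := ↥(GS A (triv k U k))) F
  have e3 := LinearMap.finrank_le_finrank_of_injective hK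
  have hsurj : LinearMap.range F = ⊤ := by
    apply Submodule.eq_top_of_finrank_eq (K := k) (V := ↥(GS A (triv k U k)))
    apply le_antisymm (Submodule.finrank_le _)
    change cc A ≤ _
    omega
  obtain ⟨b, hb⟩ := LinearMap.range_eq_top.mp hsurj ⟨g, hg⟩
  exact ⟨b.1, b.2, fun u => LinearMap.congr_fun (congrArg Subtype.val hb) u⟩

/-- Core: every `g` with `g(au) = ε(a) g(u)` is of the form `f(Λ ·)`. -/
lemma core [FiniteDimensional k U] {A : Subalgebra k U} (hA : IsRightCoidealSubalgebra k A)
    (Λ : U) (hΛA : Λ ∈ A) (hΛ0 : Λ ≠ 0)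
    (hΛ : ∀ a ∈ A, Λ * a = counit (R := k) a • Λ)
    (g : U →ₗ[k] k) (hg : ∀ a ∈ A, ∀ u, g (a * u) = counit (R := k) a * g u) :
    ∃ f : U →ₗ[k] k, ∀ u, g u = f (Λ * u) := by
  set ρ := Eact (triv k U k) with hρdef
  have hρ : ∀ a f u, ρ a f u = f (u * a) := by
    intro a f u
    have h1 : ∀ t : U ⊗[k] U, TensorProduct.lift (Ebil (triv k U k)) t f u =
        f (u * TensorProduct.lid k U ((counit (R := k)).rTensor U t)) := by
      intro t
      induction t with
      | zero => simp
      | add x y hx hy => simp only [map_add, LinearMap.add_apply, hx, hy, mul_add]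
      | tmul x y => simp [Ebil_apply, triv_apply]
    refine (h1 _).trans ?_
    simp
  let ev : (U →ₗ[k] k) →ₗ[k] k := LinearMap.applyₗ Λ
  let Y₁ : Submodule k (U →ₗ[k] k) := LinearMap.ker ev
  obtain ⟨f₀, hf₀⟩ : ∃ f₀ : U →ₗ[k] k, f₀ Λ ≠ 0 := by
    by_contra h
    push Not at h
    exact hΛ0 ((Module.forall_dual_apply_eq_zero_iff k Λ).mp h)
  have hevs : Function.Surjective ev := LinearMap.surjective_of_ne_zero (by
    intro h
    exact hf₀ (LinearMap.congr_fun h f₀))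
  have hY₁ : Module.finrank k Y₁ + 1 = Module.finrank k U := by
    have := LinearMap.finrank_range_add_finrank_ker ev
    rw [LinearMap.range_eq_top.mpr hevs, finrank_top, Module.finrank_self,
      Module.finrank_linearMap, Module.finrank_self, mul_one] at this
    show Module.finrank k (LinearMap.ker ev) + 1 = _
    omega
  have hevρ : ∀ a ∈ A, ∀ f, ev (ρ a f) = counit (R := k) a • ev f := by
    intro a ha f
    show ρ a f Λ = _ • f Λ
    rw [hρ, hΛ a ha, map_smul]
  obtain ⟨ρ₁, hρ₁⟩ := GS_sub A ρ ev hevρ Y₁ (fun y hy => hy)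
  have e1 := GS_lower hA (triv k U k)
  have e4 := GS_bound (Y := ↥Y₁) hA ρ₁
  have e5 : cc A * Module.finrank k U = cc A * Module.finrank k Y₁ + cc A := by
    rw [← hY₁]; ring
  obtain ⟨b, hb, hbg⟩ := hρ₁ (by
    change Module.finrank k U * cc A ≤ Module.finrank k (GS A ρ) at e1
    rw [mul_comm] at e1
    omega) g hg
  refine ⟨b.flip 1, fun u => ?_⟩
  rw [← hbg, LinearMap.flip_apply, hb Λ hΛA u, hρ, one_mul]
  rfl

lemma B_rAct {H : Type*} [Ring H] [HopfAlgebra k H]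
    (B : H →ₗ[k] U →ₗ[k] k) (hB : IsHopfPairingIso k B) (h : H) (x v : U) :
    B (rAct k B h x) v = B h (x * v) := by
  rw [hB.mul_right, rAct]
  induction comul (R := k) h with
  | zero => simp
  | add x y hx hy => simp only [map_add, LinearMap.add_apply, hx, hy]
  | tmul p q => simp

end main

/-- **Theorem.** Let `U`, `H` be finite-dimensional Hopf algebras, `φ : H → U*` an
isomorphism of Hopf algebras (encoded by the pairing `B`), `A` a right coideal subalgebra
of `U`, and `Λ` a nonzero right integral of `A`. Then `A† := φ⁻¹((U/A⁺U)*) = H ↼ Λ`. -/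
theorem dagger_eq_H_acted_by_integral
    {k : Type*} [Field k] {H U : Type*} [Ring H] [Ring U]
    [HopfAlgebra k H] [HopfAlgebra k U] [FiniteDimensional k H] [FiniteDimensional k U]
    (B : H →ₗ[k] U →ₗ[k] k) (hB : IsHopfPairingIso k B)
    (A : Subalgebra k U) (hA : IsRightCoidealSubalgebra k A)
    (Λ : U) (hΛA : Λ ∈ A) (hΛ0 : Λ ≠ 0)
    (hΛ : ∀ a ∈ A, Λ * a = Coalgebra.counit (R := k) a • Λ) :
    {h : H | ∀ z ∈ Submodule.span k
        {z : U | ∃ a ∈ A, ∃ u : U, Coalgebra.counit (R := k) a = 0 ∧ z = a * u},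
      B h z = 0}
    = Set.range (fun h : H => rAct k B h Λ) := by
  apply Set.Subset.antisymm
  · intro h hh
    have hg : ∀ a ∈ A, ∀ u, B h (a * u) = Coalgebra.counit (R := k) a * B h u := by
      intro a ha u
      have h1 := hh ((a - algebraMap k U (Coalgebra.counit (R := k) a)) * u)
        (Submodule.subset_span ⟨_, A.sub_mem ha (A.algebraMap_mem _), u, by simp, rfl⟩)
      rw [sub_mul, map_sub, sub_eq_zero] at h1
      rw [h1, ← Algebra.smul_def, map_smul, smul_eq_mul]
    obtain ⟨f, hf⟩ := core hA Λ hΛA hΛ0 hΛ (B h) hg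
    obtain ⟨h', rfl⟩ := hB.bijective.2 f
    refine ⟨h', hB.bijective.1 ?_⟩
    ext u
    rw [hf u]
    exact B_rAct B hB h' Λ u
  · rintro _ ⟨h, rfl⟩ z hz
    induction hz using Submodule.span_induction with
    | zero => simp
    | add x y _ _ hx hy => rw [map_add, hx, hy, add_zero]
    | smul c x _ hx => rw [map_smul, hx, smul_zero]
    | mem z hz =>
      obtain ⟨a, ha, u, h0, rfl⟩ := hz
      show B (rAct k B h Λ) (a * u) = 0
      rw [B_rAct B hB, ← mul_assoc, hΛ a ha, h0]
      simp

end
end
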